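/- arXiv:1409.3892 — 2 statements merged into one kernel-verified Lean document; each statement's English description precedes it below -/
import Mathlib

section
/- Let G be a connected graph satisfying the triangle condition (TC). Then G is weakly modular and contains no induced K_4^- and no isometric K_{3,3}^- if and only if for every pair of vertices p,q of G the following three conditions hold: (a) the interval I(p,q), partially ordered by the base-point order ⪯_p, is a modular lattice; (b) two vertices x,y ∈ I(p,q) are adjacent in G if and only if one of them covers the other in ⪯_p; (c) the subgraph of G induced by I(p,q) is an isometric subgraph of G. -/
variable {V : Type*}

/-- Triangle condition (TC). -/
def TriangleCondition (G : SimpleGraph V) : Prop :=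
  ∀ u v w : V, G.Adj v w → G.dist u v = G.dist u w → 1 ≤ G.dist u v →
    ∃ x : V, G.Adj v x ∧ G.Adj w x ∧ G.dist u x + 1 = G.dist u v

/-- Quadrangle condition (QC). -/
def QuadrangleCondition (G : SimpleGraph V) : Prop :=
  ∀ u v w z : V, G.Adj z v → G.Adj z w → G.dist v w = 2 →
    G.dist u v = G.dist u w → G.dist u z = G.dist u v + 1 →
    ∃ x : V, G.Adj v x ∧ G.Adj w x ∧ G.dist u x + 1 = G.dist u v

def WeaklyModular (G : SimpleGraph V) : Prop :=
  TriangleCondition G ∧ QuadrangleCondition G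

/-- The metric interval `I(u,v)`. -/
def gInterval (G : SimpleGraph V) (u v : V) : Set V :=
  {x : V | G.dist u x + G.dist x v = G.dist u v}

/-- `G` contains an induced `K₄` minus an edge. -/
def HasInducedK4minus (G : SimpleGraph V) : Prop :=
  ∃ a b c d : V, G.Adj a b ∧ G.Adj a c ∧ G.Adj a d ∧ G.Adj b c ∧ G.Adj b d ∧
    c ≠ d ∧ ¬ G.Adj c d

/-- `G` contains an isometric `K₃,₃` minus an edge. -/
def HasIsometricK33minus (G : SimpleGraph V) : Prop :=
  ∃ a₁ a₂ a₃ b₁ b₂ b₃ : V,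
    G.Adj a₁ b₁ ∧ G.Adj a₁ b₂ ∧ G.Adj a₁ b₃ ∧
    G.Adj a₂ b₁ ∧ G.Adj a₂ b₂ ∧ G.Adj a₂ b₃ ∧
    G.Adj a₃ b₁ ∧ G.Adj a₃ b₂ ∧
    G.dist a₁ a₂ = 2 ∧ G.dist a₁ a₃ = 2 ∧ G.dist a₂ a₃ = 2 ∧
    G.dist b₁ b₂ = 2 ∧ G.dist b₁ b₃ = 2 ∧ G.dist b₂ b₃ = 2 ∧
    G.dist a₃ b₃ = 3

/-- Base-point order: `x ⪯_p y` iff `x ∈ I(p,y)`. -/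
def bpOrder (G : SimpleGraph V) (p : V) (x y : V) : Prop :=
  x ∈ gInterval G p y

/-- `m` is the greatest lower bound of `x` and `y` in `(S, r)`. -/
def RelIsInf {α : Type*} (S : Set α) (r : α → α → Prop) (x y m : α) : Prop :=
  m ∈ S ∧ r m x ∧ r m y ∧ ∀ w ∈ S, r w x → r w y → r w m

/-- `j` is the least upper bound of `x` and `y` in `(S, r)`. -/
def RelIsSup {α : Type*} (S : Set α) (r : α → α → Prop) (x y j : α) : Prop :=
  j ∈ S ∧ r x j ∧ r y j ∧ ∀ w ∈ S, r x w → r y w → r j w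

/-- `S`, ordered by `r`, is a modular lattice: `r` is a partial order on `S`,
binary meets and joins exist, and the modular law
`x ≤ z → x ∨ (y ∧ z) = (x ∨ y) ∧ z` holds. -/
def IsModularLatticeRel {α : Type*} (S : Set α) (r : α → α → Prop) : Prop :=
  (∀ x ∈ S, r x x) ∧
  (∀ x ∈ S, ∀ y ∈ S, r x y → r y x → x = y) ∧
  (∀ x ∈ S, ∀ y ∈ S, ∀ z ∈ S, r x y → r y z → r x z) ∧
  (∀ x ∈ S, ∀ y ∈ S, ∃ m, RelIsInf S r x y m) ∧
  (∀ x ∈ S, ∀ y ∈ S, ∃ j, RelIsSup S r x y j) ∧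
  (∀ x ∈ S, ∀ y ∈ S, ∀ z ∈ S, r x z → ∀ m j j' m' : α,
    RelIsInf S r y z m → RelIsSup S r x m j →
    RelIsSup S r x y j' → RelIsInf S r j' z m' → j = m')

/-- `y` covers `x` in the restriction of the order `r` to `S`. -/
def CoversIn {α : Type*} (S : Set α) (r : α → α → Prop) (x y : α) : Prop :=
  x ≠ y ∧ r x y ∧ ∀ z ∈ S, r x z → r z y → z = x ∨ z = y

/-- `S` induces an isometric subgraph of `G`. -/
def IsIsometricSubset (G : SimpleGraph V) (S : Set V) : Prop :=
  ∀ x y : S, (G.induce S).dist x y = G.dist (x : V) (y : V)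

namespace SimpleGraph

variable {G : SimpleGraph V}

theorem Connected.dist_le_succ_of_adj (hc : G.Connected) {x y : V} (hxy : G.Adj x y) (p : V) :
    G.dist p y ≤ G.dist p x + 1 := by
  have h1 := hc.dist_triangle (u := p) (v := x) (w := y)
  have h2 := dist_eq_one_iff_adj.2 hxy
  omega

theorem Connected.dist_eq_two (hc : G.Connected) {a b c : V} (hab : G.Adj a b) (hbc : G.Adj b c)
    (hne : a ≠ c) (hn : ¬ G.Adj a c) : G.dist a c = 2 := by
  have h0 := hc.pos_dist_of_ne hne
  have h1 : G.dist a c ≠ 1 := fun h => hn (dist_eq_one_iff_adj.1 h)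
  have h2 := hc.dist_le_succ_of_adj hbc a
  have h3 := dist_eq_one_iff_adj.2 hab
  omega

theorem Connected.exists_adj_dist_succ (hc : G.Connected) {x y : V} (hne : x ≠ y) :
    ∃ u, G.Adj x u ∧ G.dist u y + 1 = G.dist x y := by
  obtain ⟨w, hw⟩ := hc.exists_walk_length_eq_dist x y
  cases w with
  | nil => exact absurd rfl hne
  | @cons _ u _ hxu w =>
    refine ⟨u, hxu, ?_⟩
    have h1 := dist_le w
    have h2 := hc.dist_triangle (u := x) (v := u) (w := y)
    have h3 := dist_eq_one_iff_adj.2 hxu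
    simp only [Walk.length_cons] at hw
    omega

end SimpleGraph

open SimpleGraph

section Intervals

variable {G : SimpleGraph V}

theorem gInterval_comm (p q : V) : gInterval G p q = gInterval G q p := by
  ext x
  simp only [gInterval, Set.mem_ofPred_eq]
  rw [G.dist_comm (u := q) (v := x), G.dist_comm (u := x) (v := p), G.dist_comm (u := q) (v := p)]
  omega

theorem bpOrder_swap {p q x y : V} (hx : x ∈ gInterval G p q) (hy : y ∈ gInterval G p q) :
    bpOrder G p x y ↔ bpOrder G q y x := by
  simp only [bpOrder, gInterval, Set.mem_ofPred_eq] at *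
  rw [G.dist_comm (u := q) (v := y), G.dist_comm (u := q) (v := x), G.dist_comm (u := y) (v := x)]
  omega

theorem bpOrder_refl (p x : V) : bpOrder G p x x := by
  simp [bpOrder, gInterval]

theorem bpOrder_antisymm (hc : G.Connected) {p x y : V} (h : bpOrder G p x y)
    (h' : bpOrder G p y x) : x = y := by
  simp only [bpOrder, gInterval, Set.mem_ofPred_eq] at *
  exact hc.dist_eq_zero_iff.1 (by omega)

theorem bpOrder_trans (hc : G.Connected) {p x y z : V} (h : bpOrder G p x y)
    (h' : bpOrder G p y z) : bpOrder G p x z := by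
  simp only [bpOrder, gInterval, Set.mem_ofPred_eq] at *
  have h1 := hc.dist_triangle (u := x) (v := y) (w := z)
  have h2 := hc.dist_triangle (u := p) (v := x) (w := z)
  omega

theorem mem_gInterval_of_bpOrder (hc : G.Connected) {p q x y : V} (hy : y ∈ gInterval G p q)
    (h : bpOrder G p x y) : x ∈ gInterval G p q :=
  bpOrder_trans hc h hy

theorem bpOrder_of_adj {p x y : V} (hxy : G.Adj x y) (h : G.dist p y = G.dist p x + 1) :
    bpOrder G p x y := by
  have := dist_eq_one_iff_adj.2 hxy
  simp only [bpOrder, gInterval, Set.mem_ofPred_eq]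
  omega

theorem coversIn_gInterval_iff (hc : G.Connected) {p q x y : V} (hy : y ∈ gInterval G p q) :
    CoversIn (gInterval G p q) (bpOrder G p) x y ↔
      G.Adj x y ∧ G.dist p y = G.dist p x + 1 := by
  constructor
  · rintro ⟨hne, hle, h⟩
    obtain ⟨u, hxu, hu⟩ := hc.exists_adj_dist_succ hne
    have h1 := dist_eq_one_iff_adj.2 hxu
    have h2 := hc.dist_triangle (u := p) (v := u) (w := y)
    have h3 := hc.dist_le_succ_of_adj hxu p
    have hxu' : bpOrder G p x u := by
      simp only [bpOrder, gInterval, Set.mem_ofPred_eq] at *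
      omega
    have huy : bpOrder G p u y := by
      simp only [bpOrder, gInterval, Set.mem_ofPred_eq] at *
      omega
    rcases h u (mem_gInterval_of_bpOrder hc hy huy) hxu' huy with rfl | rfl
    · exact absurd hxu (G.loopless.irrefl _)
    · refine ⟨hxu, ?_⟩
      simp only [bpOrder, gInterval, Set.mem_ofPred_eq] at *
      omega
  · rintro ⟨hxy, hd⟩
    refine ⟨hxy.ne, bpOrder_of_adj hxy hd, fun z _ hxz hzy => ?_⟩
    simp only [bpOrder, gInterval, Set.mem_ofPred_eq] at hxz hzy
    rcases Nat.eq_zero_or_pos (G.dist x z) with h | h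
    · exact .inl (hc.dist_eq_zero_iff.1 h).symm
    · exact .inr (hc.dist_eq_zero_iff.1 (by omega))

end Intervals

section Isometry

variable {G : SimpleGraph V}

theorem WeaklyModular.exists_adj_dist_lt_of_flat (hc : G.Connected) (hwm : WeaklyModular G)
    {p x u w : V} (hxu : G.Adj x u) (huw : G.Adj u w) (hxw : G.dist x w = 2)
    (hf : G.dist p x = G.dist p u) (hfw : G.dist p w + 1 = G.dist p u) :
    ∃ t, G.Adj x t ∧ G.Adj w t ∧ G.dist p t < G.dist p x := by
  obtain ⟨z, hxz, huz, hz⟩ := hwm.1 p x u hxu hf (by omega)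
  by_cases hzw : G.Adj z w
  · exact ⟨z, hxz, hzw.symm, by omega⟩
  have hne : z ≠ w := by
    rintro rfl
    have := dist_eq_one_iff_adj.2 hxz
    omega
  obtain ⟨y, hzy, hwy, hy⟩ := hwm.2 p z w u huz huw
    (hc.dist_eq_two huz.symm huw hne hzw) (by omega) (by omega)
  have hxy : G.dist x y = 2 := by
    refine hc.dist_eq_two hxz hzy ?_ fun h => ?_
    · rintro rfl
      omega
    · have := hc.dist_le_succ_of_adj h.symm p
      omega
  obtain ⟨t, hyt, hwt, ht⟩ := hwm.1 x y w hwy.symm (by omega) (by omega)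
  refine ⟨t, dist_eq_one_iff_adj.1 (by omega), hwt, ?_⟩
  have := hc.dist_le_succ_of_adj hyt p
  omega

theorem WeaklyModular.exists_adj_dist_lt (hc : G.Connected) (hwm : WeaklyModular G) {p y : V} :
    ∀ (n : ℕ) (x : V), G.dist x y = n → G.dist p y < G.dist p x →
      ∃ w, G.Adj x w ∧ G.dist w y + 1 = G.dist x y ∧ G.dist p w + 1 = G.dist p x := by
  intro n
  induction n with
  | zero =>
    intro x hxy hlt
    rw [hc.dist_eq_zero_iff] at hxy
    subst hxy
    omega
  | succ n ih =>
    intro x hxy hlt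
    have hne : x ≠ y := by
      rintro rfl
      omega
    obtain ⟨u, hxu, hu⟩ := hc.exists_adj_dist_succ hne
    have h1 := hc.dist_le_succ_of_adj hxu p
    have h2 := hc.dist_le_succ_of_adj hxu.symm p
    by_cases hlt' : G.dist p u < G.dist p x
    · exact ⟨u, hxu, hu, by omega⟩
    obtain ⟨w, huw, hw, hwp⟩ := ih u (by omega) (by omega)
    have hxw : G.dist x w = 2 := by
      have h3 := hc.dist_triangle (u := x) (v := w) (w := y)
      have h4 := hc.dist_le_succ_of_adj huw x
      have h5 := dist_eq_one_iff_adj.2 hxu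
      omega
    obtain ⟨t, hxt, hwt, ht⟩ : ∃ t, G.Adj x t ∧ G.Adj w t ∧ G.dist p t < G.dist p x := by
      by_cases heq : G.dist p u = G.dist p x
      · exact hwm.exists_adj_dist_lt_of_flat hc hxu huw hxw heq.symm hwp
      · obtain ⟨t, hxt, hwt, ht⟩ := hwm.2 p x w u hxu.symm huw hxw (by omega) (by omega)
        exact ⟨t, hxt, hwt, by omega⟩
    have h3 := hc.dist_triangle (u := t) (v := w) (w := y)
    have h4 := hc.dist_triangle (u := x) (v := t) (w := y)
    have h5 := dist_eq_one_iff_adj.2 hwt.symm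
    have h6 := dist_eq_one_iff_adj.2 hxt
    have h7 := hc.dist_le_succ_of_adj hxt.symm p
    exact ⟨t, hxt, by omega, by omega⟩

theorem WeaklyModular.exists_adj_dist_lt_of_rise (hc : G.Connected) (hwm : WeaklyModular G)
    {p x y u : V} (hxu : G.Adj x u) (hu : G.dist u y + 1 = G.dist x y)
    (hxy : G.dist p x = G.dist p y) (hup : G.dist p u = G.dist p x + 1) :
    ∃ t, G.Adj x t ∧ G.dist t y + 1 = G.dist x y ∧ G.dist p t + 1 = G.dist p x := by
  obtain ⟨w, huw, hw, hwp⟩ := hwm.exists_adj_dist_lt hc _ u rfl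
    (show G.dist p y < G.dist p u by omega)
  have hxw : G.dist x w = 2 := by
    have h3 := hc.dist_triangle (u := x) (v := w) (w := y)
    have h4 := hc.dist_le_succ_of_adj huw x
    have h5 := dist_eq_one_iff_adj.2 hxu
    omega
  obtain ⟨t, hxt, hwt, ht⟩ := hwm.2 p x w u hxu.symm huw hxw (by omega) (by omega)
  have h3 := hc.dist_triangle (u := t) (v := w) (w := y)
  have h4 := hc.dist_triangle (u := x) (v := t) (w := y)
  have h5 := dist_eq_one_iff_adj.2 hwt.symm
  have h6 := dist_eq_one_iff_adj.2 hxt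
  exact ⟨t, hxt, by omega, ht⟩

theorem WeaklyModular.exists_adj_mem_gInterval (hc : G.Connected) (hwm : WeaklyModular G)
    {p q x y : V} (hx : x ∈ gInterval G p q) (hy : y ∈ gInterval G p q) (hne : x ≠ y) :
    ∃ u ∈ gInterval G p q, G.Adj x u ∧ G.dist u y + 1 = G.dist x y := by
  have key : ∀ u, G.Adj x u → G.dist u y + 1 = G.dist x y →
      (G.dist p u + G.dist q u ≤ G.dist p x + G.dist q x) →
      ∃ u ∈ gInterval G p q, G.Adj x u ∧ G.dist u y + 1 = G.dist x y := by
    intro u hxu hu hle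
    refine ⟨u, ?_, hxu, hu⟩
    have h1 := hc.dist_triangle (u := p) (v := u) (w := q)
    simp only [gInterval, Set.mem_ofPred_eq] at *
    rw [G.dist_comm (u := q) (v := u), G.dist_comm (u := q) (v := x)] at hle
    omega
  simp only [gInterval, Set.mem_ofPred_eq] at hx hy
  rw [G.dist_comm (v := q)] at hx hy
  rcases lt_trichotomy (G.dist p y) (G.dist p x) with h | h | h
  · obtain ⟨u, hxu, hu, hup⟩ := hwm.exists_adj_dist_lt hc _ x rfl h
    have := hc.dist_le_succ_of_adj hxu q
    exact key u hxu hu (by omega)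
  · obtain ⟨u, hxu, hu⟩ := hc.exists_adj_dist_succ hne
    have h1 := hc.dist_le_succ_of_adj hxu q
    have h2 := hc.dist_le_succ_of_adj hxu p
    by_cases hp : G.dist p u = G.dist p x + 1
    · obtain ⟨t, hxt, ht, htp⟩ := hwm.exists_adj_dist_lt_of_rise hc hxu hu h.symm hp
      have := hc.dist_le_succ_of_adj hxt q
      exact key t hxt ht (by omega)
    by_cases hq : G.dist q u = G.dist q x + 1
    · obtain ⟨t, hxt, ht, htp⟩ := hwm.exists_adj_dist_lt_of_rise hc hxu hu (by omega) hq
      have := hc.dist_le_succ_of_adj hxt p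
      exact key t hxt ht (by omega)
    exact key u hxu hu (by omega)
  · obtain ⟨u, hxu, hu, hup⟩ := hwm.exists_adj_dist_lt hc (p := q) (y := y) _ x rfl (by omega)
    have := hc.dist_le_succ_of_adj hxu p
    exact key u hxu hu (by omega)

theorem WeaklyModular.isIsometricSubset_gInterval (hc : G.Connected) (hwm : WeaklyModular G)
    (p q : V) : IsIsometricSubset G (gInterval G p q) := by
  have key : ∀ (n : ℕ) (x y : gInterval G p q), G.dist (x : V) y = n →
      ∃ w : (G.induce (gInterval G p q)).Walk x y, w.length = n := by
    intro n
    induction n with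
    | zero =>
      intro x y hxy
      obtain rfl := Subtype.ext (hc.dist_eq_zero_iff.1 hxy)
      exact ⟨.nil, rfl⟩
    | succ n ih =>
      intro x y hxy
      have hne : (x : V) ≠ y := by
        intro h
        rw [h, dist_self] at hxy
        omega
      obtain ⟨u, hu, hxu, huy⟩ := hwm.exists_adj_mem_gInterval hc x.2 y.2 hne
      obtain ⟨w, hw⟩ := ih ⟨u, hu⟩ y (by simpa using by omega)
      have hxu' : (G.induce (gInterval G p q)).Adj x ⟨u, hu⟩ := hxu
      exact ⟨.cons hxu' w, by simp [hw]⟩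
  intro x y
  obtain ⟨w, hw⟩ := key _ x y rfl
  refine le_antisymm (hw ▸ dist_le w) ?_
  obtain ⟨w', hw'⟩ := w.reachable.exists_walk_length_eq_dist
  rw [← hw', ← Walk.length_map (Embedding.induce (gInterval G p q)).toHom w']
  exact dist_le _

end Isometry

section Lattice

variable {G : SimpleGraph V}

theorem TriangleCondition.dist_ne_of_adj (hc : G.Connected) (htc : TriangleCondition G)
    (hk : ¬ HasInducedK4minus G) {p q x y : V} (hx : x ∈ gInterval G p q)
    (hy : y ∈ gInterval G p q) (hxy : G.Adj x y) : G.dist p x ≠ G.dist p y := by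
  intro heq
  simp only [gInterval, Set.mem_ofPred_eq] at hx hy
  rw [G.dist_comm (v := q)] at hx hy
  have hpos : ∀ r, G.dist r x = G.dist r y → 1 ≤ G.dist r x := by
    intro r hr
    by_contra h
    have h1 : r = x := hc.dist_eq_zero_iff.1 (by omega)
    have h2 : r = y := hc.dist_eq_zero_iff.1 (by omega)
    exact hxy.ne (h1.symm.trans h2)
  have heq' : G.dist q x = G.dist q y := by omega
  obtain ⟨a, hxa, hya, ha⟩ := htc p x y hxy heq (hpos p heq)
  obtain ⟨b, hxb, hyb, hb⟩ := htc q x y hxy heq' (hpos q heq')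
  have h1 := hc.dist_triangle (u := p) (v := b) (w := q)
  rw [G.dist_comm (u := b)] at h1
  refine hk ⟨x, y, a, b, hxy, hxa, hxb, hya, hyb, ?_, fun hab => ?_⟩
  · rintro rfl
    omega
  · have := hc.dist_le_succ_of_adj hab p
    omega

theorem RelIsSup.unique_bpOrder (hc : G.Connected) {S : Set V} {p x y j j' : V}
    (h : RelIsSup S (bpOrder G p) x y j) (h' : RelIsSup S (bpOrder G p) x y j') : j = j' :=
  bpOrder_antisymm hc (h.2.2.2 _ h'.1 h'.2.1 h'.2.2.1) (h'.2.2.2 _ h.1 h.2.1 h.2.2.1)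

theorem RelIsInf.unique_bpOrder (hc : G.Connected) {S : Set V} {p x y j j' : V}
    (h : RelIsInf S (bpOrder G p) x y j) (h' : RelIsInf S (bpOrder G p) x y j') : j = j' :=
  bpOrder_antisymm hc (h'.2.2.2 _ h.1 h.2.1 h.2.2.1) (h.2.2.2 _ h'.1 h'.2.1 h'.2.2.1)

theorem relIsSup_of_bpOrder {p q x y : V} (hy : y ∈ gInterval G p q) (h : bpOrder G p x y) :
    RelIsSup (gInterval G p q) (bpOrder G p) x y y :=
  ⟨hy, h, bpOrder_refl _ _, fun _ _ _ hw => hw⟩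

/-- Two atoms of an interval above `z` have a join, which covers both. -/
theorem WeaklyModular.exists_relIsSup_of_adj (hc : G.Connected) (hwm : WeaklyModular G)
    (hk : ¬ HasInducedK4minus G) (h33 : ¬ HasIsometricK33minus G) {p q x y z : V}
    (hx : x ∈ gInterval G p q) (hy : y ∈ gInterval G p q)
    (hzx : G.Adj z x) (hzy : G.Adj z y) (hne : x ≠ y)
    (hpx : G.dist p x = G.dist p z + 1) (hpy : G.dist p y = G.dist p z + 1) :
    ∃ j, RelIsSup (gInterval G p q) (bpOrder G p) x y j ∧ G.Adj x j ∧ G.Adj y j := by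
  have hz : z ∈ gInterval G p q := mem_gInterval_of_bpOrder hc hx (bpOrder_of_adj hzx hpx)
  have hxy : G.dist x y = 2 := hc.dist_eq_two hzx.symm hzy hne fun h =>
    hwm.1.dist_ne_of_adj hc hk hx hy h (by omega)
  have step : ∀ r ∈ gInterval G p q, bpOrder G p x r → bpOrder G p y r →
      ∃ w, G.Adj x w ∧ G.Adj y w ∧ bpOrder G p w r ∧ G.dist p w = G.dist p x + 1 := by
    intro r hr hxr hyr
    have hzr : bpOrder G p z r := bpOrder_trans hc (bpOrder_of_adj hzx hpx) hxr
    simp only [bpOrder, gInterval, Set.mem_ofPred_eq] at hxr hyr hzr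
    rw [G.dist_comm (v := r)] at hxr hyr hzr
    obtain ⟨w, hxw, hyw, hw⟩ := hwm.2 r x y z hzx hzy hxy (by omega) (by omega)
    have h1 := hc.dist_triangle (u := p) (v := w) (w := r)
    have h2 := hc.dist_le_succ_of_adj hxw p
    rw [G.dist_comm (u := r) (v := w)] at hw
    refine ⟨w, hxw, hyw, ?_, by omega⟩
    simp only [bpOrder, gInterval, Set.mem_ofPred_eq]
    omega
  have hq : q ∈ gInterval G p q := by simp [gInterval]
  obtain ⟨w, hxw, hyw, hwq, hpw⟩ := step q hq hx hy
  refine ⟨w, ⟨hwq, bpOrder_of_adj hxw hpw, bpOrder_of_adj hyw (by omega), ?_⟩, hxw, hyw⟩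
  intro r hr hxr hyr
  obtain ⟨v, hxv, hyv, hvr, hpv⟩ := step r hr hxr hyr
  rcases eq_or_ne v w with rfl | hvw
  · exact hvr
  exfalso
  have hv : v ∈ gInterval G p q := mem_gInterval_of_bpOrder hc hr hvr
  have hw : w ∈ gInterval G p q := hwq
  have hvw2 : G.dist v w = 2 := hc.dist_eq_two hxv.symm hxw hvw fun h =>
    hwm.1.dist_ne_of_adj hc hk hv hw h (by omega)
  simp only [gInterval, Set.mem_ofPred_eq] at hx hv hw
  rw [G.dist_comm (v := q)] at hx hv hw
  obtain ⟨t, hvt, hwt, ht⟩ := hwm.2 q v w x hxv hxw hvw2 (by omega) (by omega)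
  have h1 := hc.dist_triangle (u := p) (v := t) (w := q)
  rw [G.dist_comm (u := t)] at h1
  have h2 := hc.dist_le_succ_of_adj hvt p
  have two : ∀ {a b c : V}, G.Adj a b → G.Adj b c → G.dist p c = G.dist p a + 2 →
      G.dist a c = 2 := by
    intro a b c hab hbc h
    have h3 := hc.dist_triangle (u := p) (v := a) (w := c)
    have h4 := hc.dist_le_succ_of_adj hbc a
    have h5 := dist_eq_one_iff_adj.2 hab
    omega
  have hzw := two hzx hxw (by omega)
  have hzv := two hzx hxv (by omega)
  have hzt : G.dist z t = 3 := by
    have h3 := hc.dist_triangle (u := p) (v := z) (w := t)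
    have h4 := hc.dist_le_succ_of_adj hvt z
    omega
  exact h33 ⟨x, y, t, w, v, z, hxw, hxv, hzx.symm, hyw, hyv, hzy.symm, hwt.symm, hvt.symm, hxy,
    two hxw hwt (by omega), two hyw hwt (by omega), dist_comm.trans hvw2, dist_comm.trans hzw,
    dist_comm.trans hzv, dist_comm.trans hzt⟩

/-- The first step of a geodesic from `z` to `y`, when `z` lies below `y`. -/
theorem exists_adj_bpOrder (hc : G.Connected) {p z y : V} (hzy : bpOrder G p z y) (hne : z ≠ y) :
    ∃ u, G.Adj z u ∧ G.dist u y + 1 = G.dist z y ∧ bpOrder G p u y ∧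
      G.dist p u = G.dist p z + 1 := by
  obtain ⟨u, hzu, hu⟩ := hc.exists_adj_dist_succ hne
  have h1 := hc.dist_triangle (u := p) (v := u) (w := y)
  have h2 := hc.dist_le_succ_of_adj hzu p
  simp only [bpOrder, gInterval, Set.mem_ofPred_eq] at *
  exact ⟨u, hzu, hu, by omega, by omega⟩

theorem WeaklyModular.exists_relIsSup_of_atom (hc : G.Connected) (hwm : WeaklyModular G)
    (hk : ¬ HasInducedK4minus G) (h33 : ¬ HasIsometricK33minus G) {p q y : V}
    (hy : y ∈ gInterval G p q) :
    ∀ (n : ℕ) (z x : V), G.dist z y = n → bpOrder G p z y → x ∈ gInterval G p q →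
      G.Adj z x → G.dist p x = G.dist p z + 1 →
      ∃ j, RelIsSup (gInterval G p q) (bpOrder G p) x y j ∧
        G.dist x j ≤ G.dist z y ∧ G.dist y j ≤ 1 := by
  intro n
  induction n with
  | zero =>
    intro z x hn hzy hx hzx hpx
    obtain rfl := hc.dist_eq_zero_iff.1 hn
    exact ⟨x, ⟨hx, bpOrder_refl _ _, bpOrder_of_adj hzx hpx, fun _ _ h _ => h⟩, by simp,
      (dist_eq_one_iff_adj.2 hzx).le⟩
  | succ n ih =>
    intro z x hn hzy hx hzx hpx
    have hne : z ≠ y := by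
      rintro rfl
      simp at hn
    obtain ⟨u, hzu, hu, huy, hpu⟩ := exists_adj_bpOrder hc hzy hne
    rcases eq_or_ne x u with rfl | hxu
    · exact ⟨y, relIsSup_of_bpOrder hy huy, by omega, by simp⟩
    obtain ⟨x', hx', hxx', hux'⟩ := hwm.exists_relIsSup_of_adj hc hk h33 hx
      (mem_gInterval_of_bpOrder hc hy huy) hzx hzu hxu hpx hpu
    have h1 := dist_eq_one_iff_adj.2 hux'
    have h2 : G.dist p u + G.dist u x' = G.dist p x' := hx'.2.2.1
    obtain ⟨j, hj, hj1, hj2⟩ := ih u x' (by omega) huy hx'.1 hux' (by omega)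
    have h3 := hc.dist_triangle (u := x) (v := x') (w := j)
    have h4 := dist_eq_one_iff_adj.2 hxx'
    refine ⟨j, ⟨hj.1, bpOrder_trans hc hx'.2.1 hj.2.1, hj.2.2.1, fun w hw hxw hyw => ?_⟩,
      by omega, hj2⟩
    exact hj.2.2.2 w hw (hx'.2.2.2 w hw hxw (bpOrder_trans hc huy hyw)) hyw

/-- Joins exist in intervals, and the rank is upper semimodular. -/
theorem WeaklyModular.exists_relIsSup (hc : G.Connected) (hwm : WeaklyModular G)
    (hk : ¬ HasInducedK4minus G) (h33 : ¬ HasIsometricK33minus G) {p q x : V}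
    (hx : x ∈ gInterval G p q) :
    ∀ (n : ℕ) (z y : V), G.dist z x = n → bpOrder G p z x → bpOrder G p z y →
      y ∈ gInterval G p q →
      ∃ j, RelIsSup (gInterval G p q) (bpOrder G p) x y j ∧ G.dist x j ≤ G.dist z y := by
  intro n
  induction n with
  | zero =>
    intro z y hn hzx hzy hy
    obtain rfl := hc.dist_eq_zero_iff.1 hn
    exact ⟨y, relIsSup_of_bpOrder hy hzy, le_rfl⟩
  | succ n ih =>
    intro z y hn hzx hzy hy
    have hne : z ≠ x := by
      rintro rfl
      simp at hn
    obtain ⟨u, hzu, hu, hux, hpu⟩ := exists_adj_bpOrder hc hzx hne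
    obtain ⟨j, hj, hj1, hj2⟩ := hwm.exists_relIsSup_of_atom hc hk h33 hy _ z u rfl hzy
      (mem_gInterval_of_bpOrder hc hx hux) hzu hpu
    obtain ⟨k, hk', hk1⟩ := ih u j (by omega) hux hj.2.1 hj.1
    refine ⟨k, ⟨hk'.1, hk'.2.1, bpOrder_trans hc hj.2.2.1 hk'.2.2.1, fun w hw hxw hyw => ?_⟩,
      by omega⟩
    exact hk'.2.2.2 w hw hxw (hj.2.2.2 w hw (bpOrder_trans hc hux hxw) hyw)

theorem RelIsSup.swap_bpOrder {p q x y j : V} (hx : x ∈ gInterval G p q)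
    (hy : y ∈ gInterval G p q) (h : RelIsSup (gInterval G q p) (bpOrder G q) x y j) :
    RelIsInf (gInterval G p q) (bpOrder G p) x y j := by
  rw [gInterval_comm q p] at h
  obtain ⟨hj, hxj, hyj, h⟩ := h
  exact ⟨hj, (bpOrder_swap hj hx).2 hxj, (bpOrder_swap hj hy).2 hyj, fun w hw hwx hwy =>
    (bpOrder_swap hw hj).2 (h w hw ((bpOrder_swap hw hx).1 hwx) ((bpOrder_swap hw hy).1 hwy))⟩

/-- Meets exist in intervals, and the rank is lower semimodular. -/
theorem WeaklyModular.exists_relIsInf (hc : G.Connected) (hwm : WeaklyModular G)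
    (hk : ¬ HasInducedK4minus G) (h33 : ¬ HasIsometricK33minus G) {p q x y z : V}
    (hx : x ∈ gInterval G p q) (hy : y ∈ gInterval G p q) (hz : z ∈ gInterval G p q)
    (hxz : bpOrder G p x z) (hyz : bpOrder G p y z) :
    ∃ m, RelIsInf (gInterval G p q) (bpOrder G p) x y m ∧ G.dist x m ≤ G.dist z y := by
  obtain ⟨m, hm, hd⟩ := hwm.exists_relIsSup hc hk h33 (p := q) (q := p)
    (gInterval_comm p q ▸ hx) _ z y rfl ((bpOrder_swap hx hz).1 hxz) ((bpOrder_swap hy hz).1 hyz)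
    (gInterval_comm p q ▸ hy)
  exact ⟨m, hm.swap_bpOrder hx hy, hd⟩

theorem WeaklyModular.isModularLatticeRel_gInterval (hc : G.Connected) (hwm : WeaklyModular G)
    (hk : ¬ HasInducedK4minus G) (h33 : ¬ HasIsometricK33minus G) (p q : V) :
    IsModularLatticeRel (gInterval G p q) (bpOrder G p) := by
  have hq : q ∈ gInterval G p q := by simp [gInterval]
  have hbot : ∀ x, bpOrder G p p x := fun x => by simp [bpOrder, gInterval]
  refine ⟨fun x _ => bpOrder_refl _ _, fun x _ y _ => bpOrder_antisymm hc,
    fun x _ y _ z _ => bpOrder_trans hc, fun x hx y hy => ?_, fun x hx y hy => ?_, ?_⟩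
  · obtain ⟨m, hm, -⟩ := hwm.exists_relIsInf hc hk h33 hx hy hq hx hy
    exact ⟨m, hm⟩
  · obtain ⟨j, hj, -⟩ := hwm.exists_relIsSup hc hk h33 hx _ p y rfl (hbot x) (hbot y) hy
    exact ⟨j, hj⟩
  intro x hx y hy z hz hxz m j j' m' hm hj hj' hm'
  have hjm' : bpOrder G p j m' :=
    hj.2.2.2 _ hm'.1 (hm'.2.2.2 _ hx hj'.2.1 hxz)
      (hm'.2.2.2 _ hm.1 (bpOrder_trans hc hm.2.1 hj'.2.2.1) hm.2.2.1)
  have hsup : RelIsSup (gInterval G p q) (bpOrder G p) j y j' :=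
    ⟨hj'.1, bpOrder_trans hc hjm' hm'.2.1, hj'.2.2.1, fun w hw hjw hyw =>
      hj'.2.2.2 w hw (bpOrder_trans hc hj.2.1 hjw) hyw⟩
  have hinf : RelIsInf (gInterval G p q) (bpOrder G p) m' y m :=
    ⟨hm.1, bpOrder_trans hc hj.2.2.1 hjm', hm.2.1, fun w hw hwm' hwy =>
      hm.2.2.2 w hw hwy (bpOrder_trans hc hwm' hm'.2.2.1)⟩
  obtain ⟨k, hk1, hk2⟩ := hwm.exists_relIsSup hc hk h33 hj.1 _ m y rfl hj.2.2.1 hm.2.1 hy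
  obtain rfl := hk1.unique_bpOrder hc hsup
  obtain ⟨l, hl1, hl2⟩ := hwm.exists_relIsInf hc hk h33 hm'.1 hy hj'.1 hm'.2.1 hj'.2.2.1
  obtain rfl := hl1.unique_bpOrder hc hinf
  have h1 := hsup.2.1
  have h2 := hsup.2.2.1
  have h3 := hinf.2.1
  have h4 := hinf.2.2.1
  simp only [bpOrder, gInterval, Set.mem_ofPred_eq] at hjm' h1 h2 h3 h4
  rw [G.dist_comm (u := m'), G.dist_comm (v := y)] at hl2
  exact hc.dist_eq_zero_iff.1 (by omega)

theorem TriangleCondition.adj_iff_coversIn (hc : G.Connected) (htc : TriangleCondition G)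
    (hk : ¬ HasInducedK4minus G) {p q x y : V} (hx : x ∈ gInterval G p q)
    (hy : y ∈ gInterval G p q) :
    G.Adj x y ↔ CoversIn (gInterval G p q) (bpOrder G p) x y ∨
      CoversIn (gInterval G p q) (bpOrder G p) y x := by
  rw [coversIn_gInterval_iff hc hy, coversIn_gInterval_iff hc hx]
  constructor
  · intro h
    have h1 := hc.dist_le_succ_of_adj h p
    have h2 := hc.dist_le_succ_of_adj h.symm p
    have h3 := htc.dist_ne_of_adj hc hk hx hy h
    by_cases h4 : G.dist p y = G.dist p x + 1
    · exact .inl ⟨h, h4⟩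
    · exact .inr ⟨h.symm, by omega⟩
  · rintro (h | h)
    · exact h.1
    · exact h.1.symm

end Lattice

section Converse

variable {G : SimpleGraph V}

/-- In a modular interval below `z`, the meet of two coatoms is covered by each of them. -/
theorem IsModularLatticeRel.coversIn_inf (hc : G.Connected) {u v w z m : V}
    (hmod : IsModularLatticeRel (gInterval G u z) (bpOrder G u))
    (hv : v ∈ gInterval G u z) (hw : w ∈ gInterval G u z) (hne : v ≠ w)
    (hvw : G.dist u v = G.dist u w) (hz : G.dist u z = G.dist u v + 1)
    (hm : RelIsInf (gInterval G u z) (bpOrder G u) v w m) :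
    CoversIn (gInterval G u z) (bpOrder G u) m w := by
  refine ⟨?_, hm.2.2.1, fun x hx hmx hxw => ?_⟩
  · rintro rfl
    have h : G.dist u m + G.dist m v = G.dist u v := hm.2.1
    exact hne (hc.dist_eq_zero_iff.1 (by omega)).symm
  obtain ⟨j, hj⟩ := hmod.2.2.2.2.1 x hx v hv
  obtain ⟨m', hm'⟩ := hmod.2.2.2.1 j hj.1 w hw
  have hxm : RelIsSup (gInterval G u z) (bpOrder G u) x m x :=
    ⟨hx, bpOrder_refl _ _, hmx, fun _ _ h _ => h⟩
  obtain rfl := hmod.2.2.2.2.2 x hx v hv w hw hxw m x j m' hm hxm hj hm'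
  have h1 : G.dist u v + G.dist v j = G.dist u j := hj.2.2.1
  have h2 : G.dist u j + G.dist j z = G.dist u z := hj.1
  rcases Nat.eq_zero_or_pos (G.dist v j) with h | h
  · obtain rfl := hc.dist_eq_zero_iff.1 h
    exact .inl (hm'.unique_bpOrder hc hm)
  · obtain rfl : j = z := hc.dist_eq_zero_iff.1 (by omega)
    exact .inr (bpOrder_antisymm hc hxw (hm'.2.2.2 w hw hw (bpOrder_refl _ _)))

theorem quadrangleCondition_of_isModularLatticeRel (hc : G.Connected)
    (hmod : ∀ p q : V, IsModularLatticeRel (gInterval G p q) (bpOrder G p)) :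
    QuadrangleCondition G := by
  intro u v w z hzv hzw hvw huv huz
  have hv : v ∈ gInterval G u z := bpOrder_of_adj hzv.symm huz
  have hw : w ∈ gInterval G u z := bpOrder_of_adj hzw.symm (by omega)
  have hne : v ≠ w := by
    rintro rfl
    simp at hvw
  obtain ⟨m, hm⟩ := (hmod u z).2.2.2.1 v hv w hw
  have hmw := (hmod u z).coversIn_inf hc hv hw hne huv huz hm
  have hmv := (hmod u z).coversIn_inf hc hw hv hne.symm huv.symm (by omega)
    ⟨hm.1, hm.2.2.1, hm.2.1, fun x hx h h' => hm.2.2.2 x hx h' h⟩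
  rw [coversIn_gInterval_iff hc hw] at hmw
  rw [coversIn_gInterval_iff hc hv] at hmv
  exact ⟨m, hmv.1.symm, hmw.1.symm, hmv.2.symm⟩

theorem not_hasInducedK4minus_of_coversIn (hc : G.Connected)
    (hcov : ∀ p q : V, ∀ x ∈ gInterval G p q, ∀ y ∈ gInterval G p q, G.Adj x y →
      CoversIn (gInterval G p q) (bpOrder G p) x y ∨
        CoversIn (gInterval G p q) (bpOrder G p) y x) :
    ¬ HasInducedK4minus G := by
  rintro ⟨a, b, c, d, hab, hac, had, hbc, hbd, hne, hcd⟩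
  have h := hc.dist_eq_two hac.symm had hne hcd
  have h1 := dist_eq_one_iff_adj.2 hac.symm
  have h2 := dist_eq_one_iff_adj.2 had
  have h3 := dist_eq_one_iff_adj.2 hbc.symm
  have h4 := dist_eq_one_iff_adj.2 hbd
  have ha : a ∈ gInterval G c d := by
    simp only [gInterval, Set.mem_ofPred_eq]
    omega
  have hb : b ∈ gInterval G c d := by
    simp only [gInterval, Set.mem_ofPred_eq]
    omega
  have := hcov c d a ha b hb hab
  rw [coversIn_gInterval_iff hc hb, coversIn_gInterval_iff hc ha] at this
  omega

theorem not_hasIsometricK33minus_of_isModularLatticeRel (hc : G.Connected)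
    (hmod : ∀ p q : V, IsModularLatticeRel (gInterval G p q) (bpOrder G p)) :
    ¬ HasIsometricK33minus G := by
  rintro ⟨a₁, a₂, a₃, b₁, b₂, b₃, h11, h12, h13, h21, h22, h23, h31, h32, da12, -, -, db12, db13,
    db23, d33⟩
  rw [G.dist_comm] at db13 db23 d33
  have e13 := dist_eq_one_iff_adj.2 h13.symm
  have e23 := dist_eq_one_iff_adj.2 h23.symm
  have hb1 : b₁ ∈ gInterval G b₃ a₃ := bpOrder_of_adj h31.symm (by omega)
  have hb2 : b₂ ∈ gInterval G b₃ a₃ := bpOrder_of_adj h32.symm (by omega)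
  have o11 : bpOrder G b₃ a₁ b₁ := bpOrder_of_adj h11 (by omega)
  have o12 : bpOrder G b₃ a₁ b₂ := bpOrder_of_adj h12 (by omega)
  have o21 : bpOrder G b₃ a₂ b₁ := bpOrder_of_adj h21 (by omega)
  have o22 : bpOrder G b₃ a₂ b₂ := bpOrder_of_adj h22 (by omega)
  obtain ⟨j, -, h1, h2, h⟩ := (hmod b₃ a₃).2.2.2.2.1 a₁ (mem_gInterval_of_bpOrder hc hb1 o11)
    a₂ (mem_gInterval_of_bpOrder hc hb1 o21)
  have h3 := h b₁ hb1 o11 o21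
  have h4 := h b₂ hb2 o12 o22
  have t1 := hc.dist_triangle (u := a₁) (v := j) (w := a₂)
  have t2 := hc.dist_triangle (u := b₁) (v := j) (w := b₂)
  rw [G.dist_comm (u := j) (v := a₂)] at t1
  rw [G.dist_comm (u := b₁) (v := j)] at t2
  simp only [bpOrder, gInterval, Set.mem_ofPred_eq] at h1 h2 h3 h4
  omega

end Converse

theorem statement0 (G : SimpleGraph V) (hconn : G.Connected)
    (hTC : TriangleCondition G) :
    (WeaklyModular G ∧ ¬ HasInducedK4minus G ∧ ¬ HasIsometricK33minus G) ↔
      (∀ p q : V,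
        IsModularLatticeRel (gInterval G p q) (bpOrder G p) ∧
        (∀ x ∈ gInterval G p q, ∀ y ∈ gInterval G p q,
          (G.Adj x y ↔ CoversIn (gInterval G p q) (bpOrder G p) x y ∨
            CoversIn (gInterval G p q) (bpOrder G p) y x)) ∧
        IsIsometricSubset G (gInterval G p q)) := by
  constructor
  · rintro ⟨hwm, hk, h33⟩ p q
    exact ⟨hwm.isModularLatticeRel_gInterval hconn hk h33 p q,
      fun x hx y hy => hTC.adj_iff_coversIn hconn hk hx hy,
      hwm.isIsometricSubset_gInterval hconn p q⟩
  · intro h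
    exact ⟨⟨hTC, quadrangleCondition_of_isModularLatticeRel hconn fun p q => (h p q).1⟩,
      not_hasInducedK4minus_of_coversIn hconn fun p q x hx y hy => ((h p q).2.1 x hx y hy).1,
      not_hasIsometricK33minus_of_isModularLatticeRel hconn fun p q => (h p q).1⟩
end

section
/- Let G be a connected swm-graph and let p,q be vertices with k = d(p,q) ≥ 2. The following are equivalent: (i) there is a map f from {0,1}^k to I(p,q) with d(f(A), f(B)) equal to the Hamming distance of A and B for all A,B ∈ {0,1}^k (an isometrically embedded k-cube inside I(p,q)); (ii) there is an isometric cycle of length 2k in G passing through both p and q; (iii) the interval I(p,q), partially ordered by the base-point order ⪯_p, is a complemented modular lattice. -/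
variable {V : Type*}

/-- The modular lattice `(S,r)` is complemented: it has a least and a greatest
element, and every element has a complement. -/
def IsComplementedModularLatticeRel {α : Type*} (S : Set α) (r : α → α → Prop) : Prop :=
  IsModularLatticeRel S r ∧
  ∃ bot ∈ S, ∃ top ∈ S, (∀ x ∈ S, r bot x) ∧ (∀ x ∈ S, r x top) ∧
    ∀ x ∈ S, ∃ y ∈ S, RelIsInf S r x y bot ∧ RelIsSup S r x y top

/-- There is an isometrically embedded `k`-cube (with `k = d(p,q)`)
inside the interval `I(p,q)`. -/
def CubeEmbedded (G : SimpleGraph V) (p q : V) : Prop :=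
  ∃ f : (Fin (G.dist p q) → Bool) → V,
    (∀ A, f A ∈ gInterval G p q) ∧
    ∀ A B, G.dist (f A) (f B) = (Finset.univ.filter fun i => A i ≠ B i).card

/-- There is an isometric cycle of length `2k` of `G` passing through `p` and `q`. -/
def IsIsometricCycleThrough (G : SimpleGraph V) (k : ℕ) (p q : V) : Prop :=
  ∃ c : ℕ → V,
    (∀ i < 2 * k, ∀ j < 2 * k,
      G.dist (c i) (c j) = min (max i j - min i j) (2 * k - (max i j - min i j))) ∧
    (∃ i < 2 * k, c i = p) ∧ ∃ j < 2 * k, c j = q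

/-- The standing hypotheses: a connected weakly modular graph with no induced `K₄⁻` and no
isometric `K₃,₃⁻`. -/
structure IsSwm (G : SimpleGraph V) : Prop where
  conn : G.Connected
  tc : TriangleCondition G
  qc : QuadrangleCondition G
  k4 : ¬ HasInducedK4minus G
  k33 : ¬ HasIsometricK33minus G

namespace IsSwm

variable {G : SimpleGraph V} {p q : V}

theorem tri (hG : IsSwm G) (a b c : V) : G.dist a c ≤ G.dist a b + G.dist b c :=
  hG.conn.dist_triangle

theorem eq_of_dist (hG : IsSwm G) {a b : V} (h : G.dist a b = 0) : a = b :=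
  hG.conn.dist_eq_zero_iff.mp h

theorem one_le_dist (hG : IsSwm G) {a b : V} (h : a ≠ b) : 1 ≤ G.dist a b :=
  Nat.one_le_iff_ne_zero.mpr fun h0 => h (hG.eq_of_dist h0)

theorem two_le_dist (hG : IsSwm G) {a b : V} (h : a ≠ b) (h' : ¬ G.Adj a b) :
    2 ≤ G.dist a b := by
  have h1 := hG.one_le_dist h
  have h2 : G.dist a b ≠ 1 := fun h3 => h' (SimpleGraph.dist_eq_one_iff_adj.mp h3)
  omega

theorem dist_of_adj {a b : V} (h : G.Adj a b) : G.dist a b = 1 :=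
  SimpleGraph.dist_eq_one_iff_adj.mpr h

theorem mem_symm {x : V} (h : x ∈ gInterval G p q) : x ∈ gInterval G q p := by
  simp only [gInterval, Set.mem_ofPred_eq] at *
  rw [G.dist_comm (u := q) (v := x), G.dist_comm (u := x) (v := p), G.dist_comm (u := q) (v := p)]
  omega

theorem le_trans (hG : IsSwm G) {x y z : V} (h : bpOrder G p x y) (h' : bpOrder G p y z) :
    bpOrder G p x z := by
  simp only [bpOrder, gInterval, Set.mem_ofPred_eq] at *
  have := hG.tri p x z
  have := hG.tri x y z
  omega

theorem le_refl (x : V) : bpOrder G p x x := by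
  simp [bpOrder, gInterval]

theorem bot_le (x : V) : bpOrder G p p x := by
  simp [bpOrder, gInterval]

theorem le_antisymm (hG : IsSwm G) {x y : V} (h : bpOrder G p x y) (h' : bpOrder G p y x) :
    x = y := by
  simp only [bpOrder, gInterval, Set.mem_ofPred_eq] at *
  exact hG.eq_of_dist (by omega)

theorem dist_le_of_le {x y : V} (h : bpOrder G p x y) : G.dist p x ≤ G.dist p y := by
  simp only [bpOrder, gInterval, Set.mem_ofPred_eq] at *
  omega

theorem eq_of_le_of_dist_le (hG : IsSwm G) {x y : V} (h : bpOrder G p x y)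
    (h' : G.dist p y ≤ G.dist p x) : x = y := by
  simp only [bpOrder, gInterval, Set.mem_ofPred_eq] at *
  exact hG.eq_of_dist (by omega)

theorem bot_mem : p ∈ gInterval G p q := by simp [gInterval]

theorem top_mem : q ∈ gInterval G p q := by simp [gInterval]

/-- The interval is a down-set of the base-point order. -/
theorem mem_of_le (hG : IsSwm G) {x y : V} (hy : y ∈ gInterval G p q) (h : bpOrder G p x y) :
    x ∈ gInterval G p q := hG.le_trans (p := p) h hy

/-- On the interval, exchanging the end points reverses the order. -/
theorem le_swap (hG : IsSwm G) {x y : V} (hx : x ∈ gInterval G p q) (hy : y ∈ gInterval G p q)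
    (h : bpOrder G p x y) : bpOrder G q y x := by
  simp only [bpOrder, gInterval, Set.mem_ofPred_eq] at *
  have := hG.tri x y q
  have := hG.tri p x q
  have e1 := G.dist_comm (u := q) (v := y)
  have e2 := G.dist_comm (u := y) (v := x)
  have e3 := G.dist_comm (u := q) (v := x)
  omega

theorem le_swap_iff (hG : IsSwm G) {x y : V} (hx : x ∈ gInterval G p q)
    (hy : y ∈ gInterval G p q) : bpOrder G q y x ↔ bpOrder G p x y :=
  ⟨hG.le_swap (mem_symm hy) (mem_symm hx), hG.le_swap hx hy⟩

theorem dist_swap {x : V} (hx : x ∈ gInterval G p q) :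
    G.dist p x + G.dist q x = G.dist p q := by
  rw [G.dist_comm (u := q)]; exact hx

theorem le_of_adj {x y : V} (h : G.Adj x y) (h' : G.dist p y = G.dist p x + 1) :
    bpOrder G p x y := by
  simp only [bpOrder, gInterval, Set.mem_ofPred_eq] at *
  rw [dist_of_adj h, h']

theorem exists_pred (hG : IsSwm G) {m x : V} (h : m ≠ x) :
    ∃ y, G.Adj y x ∧ G.dist m y + 1 = G.dist m x := by
  obtain ⟨w, hw⟩ := hG.conn.exists_walk_length_eq_dist x m
  cases w with
  | nil => exact absurd rfl h
  | @cons _ y _ hadj w =>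
    refine ⟨y, hadj.symm, ?_⟩
    have h1 := SimpleGraph.dist_le w
    have h2 := hG.tri m y x
    have h3 := dist_of_adj hadj.symm
    have e1 := G.dist_comm (u := y) (v := m)
    have e2 := G.dist_comm (u := x) (v := m)
    simp only [SimpleGraph.Walk.length_cons] at hw
    omega

theorem exists_cover (hG : IsSwm G) {m x : V} (hmx : bpOrder G p m x) (h : m ≠ x) :
    ∃ y, G.Adj m y ∧ G.dist p y = G.dist p m + 1 ∧ bpOrder G p y x := by
  obtain ⟨y, hy, hd⟩ := hG.exists_pred h.symm
  refine ⟨y, hy.symm, ?_⟩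
  simp only [bpOrder, gInterval, Set.mem_ofPred_eq] at *
  have h1 := hG.tri p y x
  have h2 := hG.tri p m y
  have h3 := dist_of_adj hy.symm
  have e1 := G.dist_comm (u := x) (v := y)
  have e2 := G.dist_comm (u := x) (v := m)
  omega

theorem not_adj_of_dist_eq (hG : IsSwm G) {x y : V} (hx : x ∈ gInterval G p q)
    (hy : y ∈ gInterval G p q) (h : G.dist p x = G.dist p y) : ¬ G.Adj x y := by
  intro hxy
  have sx := dist_swap hx
  have sy := dist_swap hy
  have hp : 1 ≤ G.dist p x := by
    by_contra h0
    have h1 := hG.eq_of_dist (a := p) (b := x) (by omega)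
    have h2 := hG.eq_of_dist (a := p) (b := y) (by omega)
    exact hxy.ne (h1.symm.trans h2)
  have hq : 1 ≤ G.dist q x := by
    by_contra h0
    have h1 := hG.eq_of_dist (a := q) (b := x) (by omega)
    have h2 := hG.eq_of_dist (a := q) (b := y) (by omega)
    exact hxy.ne (h1.symm.trans h2)
  obtain ⟨u, hu1, hu2, hu3⟩ := hG.tc p x y hxy h hp
  obtain ⟨w, hw1, hw2, hw3⟩ := hG.tc q x y hxy (by omega) hq
  have h1 := hG.tri p u q
  have h2 := hG.tri u w q
  have e1 := G.dist_comm (u := q) (v := w)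
  refine hG.k4 ⟨x, y, u, w, hxy, hu1, hw1, hu2, hw2, ?_, ?_⟩
  · rintro rfl
    have := G.dist_self (v := u)
    omega
  · intro huw
    have := dist_of_adj huw
    omega

theorem dist_eq_two (hG : IsSwm G) {x y z : V} (hx : x ∈ gInterval G p q)
    (hy : y ∈ gInterval G p q) (h : G.dist p x = G.dist p y) (hne : x ≠ y) (hxz : G.Adj z x)
    (hyz : G.Adj z y) : G.dist x y = 2 := by
  have h1 := hG.two_le_dist hne (hG.not_adj_of_dist_eq hx hy h)
  have h2 := hG.tri x z y
  have h3 := dist_of_adj hxz.symm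
  have h4 := dist_of_adj hyz
  omega

/-- Two upper covers of `w` have a common upper cover below any common upper bound. -/
theorem exists_common_cover (hG : IsSwm G) {x y w u : V} (hu : u ∈ gInterval G p q)
    (hne : x ≠ y) (hx : G.Adj w x) (hy : G.Adj w y) (hdx : G.dist p x = G.dist p w + 1)
    (hdy : G.dist p y = G.dist p w + 1) (hxu : bpOrder G p x u) (hyu : bpOrder G p y u) :
    ∃ z, G.Adj x z ∧ G.Adj y z ∧ G.dist p z = G.dist p w + 2 ∧ bpOrder G p z u := by
  have h2 := hG.dist_eq_two (hG.mem_of_le hu hxu) (hG.mem_of_le hu hyu) (by omega) hne hx hy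
  have hwu : bpOrder G p w u := hG.le_trans (le_of_adj hx hdx) hxu
  simp only [bpOrder, gInterval, Set.mem_ofPred_eq] at *
  have e1 := G.dist_comm (u := u) (v := x)
  have e2 := G.dist_comm (u := u) (v := y)
  have e3 := G.dist_comm (u := u) (v := w)
  obtain ⟨z, hz1, hz2, hz3⟩ := hG.qc u x y w hx hy h2 (by omega) (by omega)
  refine ⟨z, hz1, hz2, ?_⟩
  have h4 := hG.tri p z u
  have h5 := hG.tri p x z
  have h6 := dist_of_adj hz1
  have e4 := G.dist_comm (u := u) (v := z)
  omega

/-- Two lower covers of `z` have a common lower cover. -/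
theorem exists_common_cocover (hG : IsSwm G) {x y z : V} (hx : x ∈ gInterval G p q)
    (hy : y ∈ gInterval G p q) (hne : x ≠ y) (hxz : G.Adj x z) (hyz : G.Adj y z)
    (hdx : G.dist p z = G.dist p x + 1) (hdy : G.dist p z = G.dist p y + 1) :
    ∃ w, G.Adj w x ∧ G.Adj w y ∧ G.dist p w + 1 = G.dist p x := by
  have h2 := hG.dist_eq_two hx hy (by omega) hne hxz.symm hyz.symm
  obtain ⟨w, hw1, hw2, hw3⟩ := hG.qc p x y z hxz.symm hyz.symm h2 (by omega) (by omega)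
  exact ⟨w, hw1.symm, hw2.symm, hw3⟩

theorem common_cover_unique (hG : IsSwm G) {v w z z' : V} (hz : z ∈ gInterval G p q)
    (hz' : z' ∈ gInterval G p q) (hne : v ≠ w) (hvz : G.Adj v z) (hvz' : G.Adj v z')
    (hwz : G.Adj w z) (hwz' : G.Adj w z') (hdv : G.dist p z = G.dist p v + 1)
    (hdw : G.dist p z = G.dist p w + 1) (hd : G.dist p z' = G.dist p z) : z = z' := by
  by_contra hzz
  have hv := hG.mem_of_le hz (le_of_adj hvz hdv)
  have hw := hG.mem_of_le hz (le_of_adj hwz hdw)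
  obtain ⟨t, ht1, ht2, ht3, -⟩ := hG.exists_common_cover (top_mem (q := q)) hzz hvz hvz' hdv
    (by omega) hz hz'
  obtain ⟨x, hx1, hx2, hx3⟩ := hG.exists_common_cocover hv hw hne hvz hwz hdv hdw
  have key : ∀ a b c, G.Adj a b → G.Adj b c → G.dist p c = G.dist p a + 2 →
      G.dist a c = 2 := by
    intro a b c hab hbc h
    have h1 := hG.tri a b c
    have h2 := hG.tri p a c
    have h3 := dist_of_adj hab
    have h4 := dist_of_adj hbc
    omega
  have hcomm := fun a b => G.dist_comm (u := a) (v := b)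
  refine hG.k33 ⟨z, z', x, v, w, t, hvz.symm, hwz.symm, ht1, hvz'.symm, hwz'.symm, ht2, hx1, hx2,
    hG.dist_eq_two hz hz' hd.symm hzz hvz hvz', ?_, ?_,
    hG.dist_eq_two hv hw (by omega) hne hvz.symm hwz.symm,
    key _ _ _ hvz ht1 (by omega), key _ _ _ hwz ht1 (by omega), ?_⟩
  · rw [hcomm]; exact key _ _ _ hx1 hvz (by omega)
  · rw [hcomm]; exact key _ _ _ hx1 hvz' (by omega)
  · have h1 := hG.tri p x t
    have h2 := hG.tri x v t
    have h3 := dist_of_adj hx1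
    have h4 := key _ _ _ hvz ht1 (by omega)
    omega

/-- Upper semimodularity of the rank function. -/
theorem exists_upper_bound (hG : IsSwm G) {m x y : V} (hx : x ∈ gInterval G p q)
    (hy : y ∈ gInterval G p q) (hmx : bpOrder G p m x) (hmy : bpOrder G p m y) :
    ∃ u ∈ gInterval G p q, bpOrder G p x u ∧ bpOrder G p y u ∧
      G.dist p u + G.dist p m ≤ G.dist p x + G.dist p y := by
  induction hn : G.dist p x + G.dist p y - 2 * G.dist p m using Nat.strong_induction_on
    generalizing m x y with
  | _ n ih =>
  have rx := dist_le_of_le hmx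
  have ry := dist_le_of_le hmy
  by_cases h1 : m = x
  · subst h1
    exact ⟨y, hy, hmy, le_refl y, by omega⟩
  by_cases h2 : m = y
  · subst h2
    exact ⟨x, hx, le_refl x, hmx, by omega⟩
  obtain ⟨x1, ax, dx, lx⟩ := hG.exists_cover hmx h1
  obtain ⟨y1, ay, dy, ly⟩ := hG.exists_cover hmy h2
  have rx1 := dist_le_of_le lx
  have ry1 := dist_le_of_le ly
  by_cases h3 : x1 = y1
  · subst h3
    obtain ⟨u, hu, h4, h5, h6⟩ := ih _ (by omega) hx hy lx ly rfl
    exact ⟨u, hu, h4, h5, by omega⟩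
  obtain ⟨z, xz, yz, dz, hz⟩ := hG.exists_common_cover (top_mem (q := q)) h3 ax ay dx dy
    (hG.mem_of_le hx lx) (hG.mem_of_le hy ly)
  obtain ⟨u1, hu1, xu, zu, du⟩ := ih _ (by omega) hx hz lx (le_of_adj xz (by omega)) rfl
  obtain ⟨u2, hu2, yu, zu', du'⟩ := ih _ (by omega) hy hz ly (le_of_adj yz (by omega)) rfl
  have := dist_le_of_le zu
  have := dist_le_of_le zu'
  obtain ⟨u, hu, l1, l2, du''⟩ := ih _ (by omega) hu1 hu2 zu zu' rfl
  exact ⟨u, hu, hG.le_trans xu l1, hG.le_trans yu l2, by omega⟩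

/-- Lower semimodularity of the rank function. -/
theorem exists_lower_bound (hG : IsSwm G) {u x y : V} (hu : u ∈ gInterval G p q)
    (hxu : bpOrder G p x u) (hyu : bpOrder G p y u) :
    ∃ m, bpOrder G p m x ∧ bpOrder G p m y ∧
      G.dist p x + G.dist p y ≤ G.dist p u + G.dist p m := by
  have hx := hG.mem_of_le hu hxu
  have hy := hG.mem_of_le hu hyu
  obtain ⟨m, hm, h1, h2, h3⟩ := hG.exists_upper_bound (mem_symm hx) (mem_symm hy)
    (hG.le_swap hx hu hxu) (hG.le_swap hy hu hyu)
  have hm' := mem_symm hm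
  refine ⟨m, hG.le_swap (mem_symm hx) hm h1, hG.le_swap (mem_symm hy) hm h2, ?_⟩
  have := dist_swap hx
  have := dist_swap hy
  have := dist_swap hu
  have := dist_swap hm'
  omega

theorem exists_sup_of_le (hG : IsSwm G) {m x y : V} (hx : x ∈ gInterval G p q)
    (hy : y ∈ gInterval G p q) (hmx : bpOrder G p m x) (hmy : bpOrder G p m y) :
    ∃ j, RelIsSup (gInterval G p q) (bpOrder G p) x y j := by
  induction hn : G.dist p q - G.dist p m using Nat.strong_induction_on generalizing m x y with
  | _ n ih =>
  have rx := dist_le_of_le hmx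
  have rq := dist_le_of_le (p := p) hx
  by_cases h1 : m = x
  · subst h1
    exact ⟨y, hy, hmy, le_refl y, fun w _ _ h => h⟩
  by_cases h2 : m = y
  · subst h2
    exact ⟨x, hx, le_refl x, hmx, fun w _ h _ => h⟩
  obtain ⟨x1, ax, dx, lx⟩ := hG.exists_cover hmx h1
  obtain ⟨y1, ay, dy, ly⟩ := hG.exists_cover hmy h2
  have rx1 := dist_le_of_le lx
  have ry1 := dist_le_of_le ly
  by_cases h3 : x1 = y1
  · subst h3
    exact ih _ (by omega) hx hy lx ly rfl
  obtain ⟨z, xz, yz, dz, hz⟩ := hG.exists_common_cover (top_mem (q := q)) h3 ax ay dx dy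
    (hG.mem_of_le hx lx) (hG.mem_of_le hy ly)
  have hyz : bpOrder G p y1 z := le_of_adj yz (by omega)
  obtain ⟨s, hs, xs, zs, ms⟩ := ih _ (by omega) hx hz lx (le_of_adj xz (by omega)) rfl
  obtain ⟨t, ht, st, yt, mt⟩ := ih _ (by omega) hs hy (hG.le_trans hyz zs) ly rfl
  refine ⟨t, ht, hG.le_trans xs st, yt, fun u hu xu yu => mt u hu (ms u hu xu ?_) yu⟩
  obtain ⟨z', xz', yz', dz', hz'⟩ := hG.exists_common_cover hu h3 ax ay dx dy
    (hG.le_trans lx xu) (hG.le_trans ly yu)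
  rwa [hG.common_cover_unique hz (hG.mem_of_le hu hz') h3 xz xz' yz yz' (by omega) (by omega)
    (by omega)]

theorem exists_sup (hG : IsSwm G) {x y : V} (hx : x ∈ gInterval G p q)
    (hy : y ∈ gInterval G p q) : ∃ j, RelIsSup (gInterval G p q) (bpOrder G p) x y j :=
  hG.exists_sup_of_le hx hy (bot_le x) (bot_le y)

theorem exists_inf (hG : IsSwm G) {x y : V} (hx : x ∈ gInterval G p q)
    (hy : y ∈ gInterval G p q) : ∃ m, RelIsInf (gInterval G p q) (bpOrder G p) x y m := by
  obtain ⟨m, hm, h1, h2, h3⟩ := hG.exists_sup (mem_symm hx) (mem_symm hy)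
  have hm' := mem_symm hm
  exact ⟨m, hm', (hG.le_swap_iff hm' hx).mp h1, (hG.le_swap_iff hm' hy).mp h2,
    fun w hw hwx hwy => (hG.le_swap_iff hw hm').mp
      (h3 w (mem_symm hw) (hG.le_swap hw hx hwx) (hG.le_swap hw hy hwy))⟩

theorem dist_inf_add_dist_sup (hG : IsSwm G) {x y m j : V} (hx : x ∈ gInterval G p q)
    (hy : y ∈ gInterval G p q) (hm : RelIsInf (gInterval G p q) (bpOrder G p) x y m)
    (hj : RelIsSup (gInterval G p q) (bpOrder G p) x y j) :
    G.dist p j + G.dist p m = G.dist p x + G.dist p y := by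
  obtain ⟨hm, mx, my, hmax⟩ := hm
  obtain ⟨hj, xj, yj, hmin⟩ := hj
  obtain ⟨u, hu, xu, yu, h1⟩ := hG.exists_upper_bound hx hy mx my
  obtain ⟨l, lx, ly, h2⟩ := hG.exists_lower_bound hj xj yj
  have h3 := dist_le_of_le (hmin u hu xu yu)
  have h4 := dist_le_of_le (hmax l (hG.mem_of_le hx lx) lx ly)
  omega

theorem dist_eq_add_step (hG : IsSwm G) {x y : V} (hr : 2 ≤ G.dist p x)
    (ih : ∀ x', bpOrder G p x' x → x' ≠ x → G.dist x' y = G.dist p x' + G.dist p y) :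
    G.dist x y = G.dist p x + G.dist p y := by
  have hcomm := fun a b => G.dist_comm (u := a) (v := b)
  have hpx : p ≠ x := by rintro rfl; simp at hr
  obtain ⟨x1, a1, d1⟩ := hG.exists_pred hpx
  have hpx1 : p ≠ x1 := by
    rintro rfl
    rw [G.dist_self] at d1
    omega
  obtain ⟨x2, a2, d2⟩ := hG.exists_pred hpx1
  have l1 : bpOrder G p x1 x := le_of_adj a1 d1.symm
  have l2 : bpOrder G p x2 x := hG.le_trans (le_of_adj a2 d2.symm) l1
  have e1 := ih x1 l1 a1.ne
  have e2 := ih x2 l2 (by rintro rfl; omega)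
  have d02 : G.dist x x2 = 2 := by
    simp only [bpOrder, gInterval, Set.mem_ofPred_eq] at l2
    rw [hcomm x x2]
    omega
  have low : ∀ z, G.Adj x z → G.Adj x2 z → G.dist z y = G.dist p x + G.dist p y - 1 := by
    intro z h1 h2
    have t1 := hG.tri p z x
    have t2 := hG.tri p x2 z
    have t3 := dist_of_adj h1.symm
    have t4 := dist_of_adj h2
    rw [ih z (le_of_adj h1.symm (by omega)) h1.ne']
    omega
  have t1 := hG.tri x p y
  have t2 := hG.tri x1 x y
  have t3 := hG.tri x x1 y
  have t4 := dist_of_adj a1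
  have c1 := hcomm x p
  have c2 := hcomm x1 x
  have c3 := hcomm y x
  have c4 := hcomm y x1
  have c5 := hcomm y x2
  rcases (by omega : G.dist x y + 2 = G.dist p x + G.dist p y ∨
    G.dist x y + 1 = G.dist p x + G.dist p y ∨ G.dist x y = G.dist p x + G.dist p y) with h | h | h
  · obtain ⟨z, hz1, hz2, hz3⟩ := hG.qc y x x2 x1 a1 a2.symm d02 (by omega) (by omega)
    have := low z hz1 hz2
    have := hcomm y z
    omega
  · exfalso
    obtain ⟨z, hz1, hz2, hz3⟩ := hG.tc y x x1 a1.symm (by omega) (by omega)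
    have c6 := hcomm y z
    have s1 := hG.tri p x1 z
    have s2 := hG.tri p z x
    have s3 := dist_of_adj hz2
    have s4 := dist_of_adj hz1.symm
    have hz : G.dist p z = G.dist p x := by
      by_contra hne
      have := ih z (le_of_adj hz1.symm (by omega)) hz1.ne'
      omega
    have d2z : G.dist z x2 = 2 := by
      have := hG.tri p x2 z
      have := hG.tri x2 x1 z
      have := dist_of_adj a2
      have := hcomm z x2
      omega
    obtain ⟨s, hs1, hs2, hs3⟩ := hG.qc y z x2 x1 hz2 a2.symm d2z (by omega) (by omega)
    have c7 := hcomm y s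
    have hxs : G.dist x s = 2 := by
      have := hG.tri x z s
      have := hG.tri x s y
      have := dist_of_adj hz1
      have := dist_of_adj hs1
      omega
    obtain ⟨t, ht1, ht2, ht3⟩ := hG.tc x x2 s hs2 (by omega) (by omega)
    have hxt : G.Adj x t := SimpleGraph.dist_eq_one_iff_adj.mp (by omega)
    have := low t hxt ht1
    have := hG.tri t s y
    have := dist_of_adj ht2.symm
    omega
  · exact h

/-- If `p` is the only common lower bound of `x` and `y`, then `p` lies between them. -/
theorem dist_eq_add (hG : IsSwm G) {x y : V} (hx : x ∈ gInterval G p q)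
    (hy : y ∈ gInterval G p q) (hd : ∀ w, bpOrder G p w x → bpOrder G p w y → w = p) :
    G.dist x y = G.dist p x + G.dist p y := by
  induction hn : G.dist p x + G.dist p y using Nat.strong_induction_on generalizing x y with
  | _ n ih =>
  subst hn
  have hlt : ∀ {a b : V}, bpOrder G p a b → a ≠ b → G.dist p a < G.dist p b := by
    intro a b hab hne
    by_contra h
    exact hne (hG.eq_of_le_of_dist_le hab (by omega))
  by_cases hx2 : 2 ≤ G.dist p x
  · refine hG.dist_eq_add_step hx2 fun x' hle hne => ?_
    have := hlt hle hne
    exact ih _ (by omega) (hG.mem_of_le hx hle) hy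
      (fun w h1 h2 => hd w (hG.le_trans h1 hle) h2) rfl
  by_cases hy2 : 2 ≤ G.dist p y
  · rw [G.dist_comm, add_comm]
    refine hG.dist_eq_add_step hy2 fun y' hle hne => ?_
    have := hlt hle hne
    rw [G.dist_comm, add_comm]
    exact ih _ (by omega) hx (hG.mem_of_le hy hle)
      (fun w h1 h2 => hd w h1 (hG.le_trans h2 hle)) rfl
  by_cases hx0 : G.dist p x = 0
  · rw [hx0, ← hG.eq_of_dist hx0, zero_add]
  by_cases hy0 : G.dist p y = 0
  · rw [hy0, ← hG.eq_of_dist hy0, add_zero, G.dist_comm]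
  have hne : x ≠ y := by
    rintro rfl
    have := hd x (le_refl x) (le_refl x)
    subst this
    simp at hx0
  have h1 := hG.two_le_dist hne (hG.not_adj_of_dist_eq hx hy (by omega))
  have h2 := hG.tri x p y
  have h3 := G.dist_comm (u := x) (v := p)
  omega

end IsSwm

/-- A strictly monotone modular rank function on a bounded lattice. -/
structure IsModularRank {L : Type*} [Lattice L] [BoundedOrder L] (r : L → ℕ) : Prop where
  bot : r ⊥ = 0
  mono : Monotone r
  eq_of_le : ∀ {x y : L}, x ≤ y → r y ≤ r x → x = y
  sup_add_inf : ∀ x y : L, r (x ⊔ y) + r (x ⊓ y) = r x + r y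

namespace IsModularRank

variable {L : Type*} [Lattice L] [BoundedOrder L] {r : L → ℕ}

theorem eq_bot (hr : IsModularRank r) {x : L} (h : r x = 0) : x = ⊥ :=
  (hr.eq_of_le bot_le (by omega)).symm

theorem modular_law (hr : IsModularRank r) {x y z : L} (h : x ≤ z) :
    x ⊔ y ⊓ z = (x ⊔ y) ⊓ z := by
  refine hr.eq_of_le (sup_le (le_inf le_sup_left h) (inf_le_inf_right z le_sup_right)) ?_
  have h1 := hr.sup_add_inf x (y ⊓ z)
  have h2 := hr.sup_add_inf (x ⊔ y) z
  have h3 := hr.sup_add_inf x y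
  have h4 := hr.sup_add_inf y z
  have h5 : x ⊓ (y ⊓ z) = x ⊓ y := by
    rw [← inf_assoc, inf_eq_left]
    exact inf_le_left.trans h
  have h6 : x ⊔ y ⊔ z = y ⊔ z := by
    rw [sup_assoc, sup_eq_right]
    exact h.trans le_sup_right
  rw [h5] at h1
  rw [h6] at h2
  omega

theorem sup_of_not_le (hr : IsModularRank r) {x a : L} (ha : r a = 1) (h : ¬ a ≤ x) :
    r (x ⊔ a) = r x + 1 := by
  have h1 := hr.sup_add_inf x a
  have h2 := hr.mono (inf_le_right : x ⊓ a ≤ a)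
  have h3 : r (x ⊓ a) ≠ 1 := by
    intro h3
    have h4 := hr.eq_of_le (inf_le_right : x ⊓ a ≤ a) (by omega)
    exact h (h4 ▸ inf_le_left)
  omega

theorem exists_isCompl (hr : IsModularRank r) (h : ∀ x ≠ ⊤, ∃ a, r a = 1 ∧ ¬ a ≤ x) (x : L) :
    ∃ y, x ⊓ y = ⊥ ∧ x ⊔ y = ⊤ := by
  suffices H : ∀ n y, r ⊤ - r y = n → x ⊓ y = ⊥ → ∃ y, x ⊓ y = ⊥ ∧ x ⊔ y = ⊤ from
    H _ ⊥ rfl (inf_bot_eq x)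
  intro n
  induction n using Nat.strong_induction_on with
  | _ n ih =>
  intro y hy hxy
  by_cases htop : x ⊔ y = ⊤
  · exact ⟨y, hxy, htop⟩
  obtain ⟨a, ha, hle⟩ := h _ htop
  have h1 := hr.sup_of_not_le ha hle
  have h2 := hr.sup_of_not_le (x := y) ha fun h => hle (h.trans le_sup_right)
  have h3 := hr.sup_add_inf x (y ⊔ a)
  have h4 := hr.sup_add_inf x y
  rw [← sup_assoc] at h3
  rw [hxy, hr.bot] at h4
  have h5 := hr.mono (le_top : y ⊔ a ≤ ⊤)
  exact ih _ (by omega) (y ⊔ a) rfl (hr.eq_bot (by omega))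

theorem exists_atoms_sup_eq_top (hr : IsModularRank r)
    (h : ∀ x ≠ ⊤, ∃ a, r a = 1 ∧ ¬ a ≤ x) :
    ∃ a : Fin (r ⊤) → L, (∀ i, r (a i) = 1) ∧ Finset.univ.sup a = ⊤ := by
  classical
  choose! g hg hg' using h
  let x : ℕ → L := fun n => Nat.rec ⊥ (fun _ y => y ⊔ g y) n
  have hne : ∀ n < r ⊤, r (x n) = n → x n ≠ ⊤ := by
    intro n hn h1 h2
    rw [h2] at h1
    omega
  have hx : ∀ n ≤ r ⊤, r (x n) = n := by
    intro n
    induction n with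
    | zero => exact fun _ => hr.bot
    | succ n ih =>
      intro hn
      have h1 := ih (by omega)
      have h2 := hne n (by omega) h1
      exact (hr.sup_of_not_le (hg _ h2) (hg' _ h2)).trans (by rw [h1])
  refine ⟨fun i => g (x i), fun i => hg _ (hne i i.2 (hx i i.2.le)), ?_⟩
  have hle : ∀ n ≤ r ⊤, x n ≤ Finset.univ.sup fun i : Fin (r ⊤) => g (x i) := by
    intro n
    induction n with
    | zero => exact fun _ => bot_le
    | succ n ih =>
      intro hn
      exact sup_le (ih (by omega)) (Finset.le_sup (f := fun i : Fin (r ⊤) => g (x i))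
        (Finset.mem_univ ⟨n, hn⟩))
  exact top_unique ((hr.eq_of_le le_top (hx _ le_rfl).ge).ge.trans (hle _ le_rfl))

theorem finset_sup_le_card (hr : IsModularRank r) {ι : Type*} {a : ι → L} (ha : ∀ i, r (a i) = 1)
    (S : Finset ι) : r (S.sup a) ≤ S.card := by
  classical
  induction S using Finset.induction_on with
  | empty => simp [hr.bot]
  | insert i S hi ih =>
    rw [Finset.sup_insert, Finset.card_insert_of_notMem hi]
    have := hr.sup_add_inf (a i) (S.sup a)
    have := ha i
    omega

theorem sup_sup_compl {ι : Type*} [Fintype ι] [DecidableEq ι] {a : ι → L}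
    (htop : Finset.univ.sup a = ⊤) (S : Finset ι) : S.sup a ⊔ Sᶜ.sup a = ⊤ := by
  rw [← Finset.sup_union, Finset.union_compl, htop]

theorem finset_sup_eq_card (hr : IsModularRank r) {ι : Type*} [Fintype ι] [DecidableEq ι]
    {a : ι → L} (ha : ∀ i, r (a i) = 1) (htop : Finset.univ.sup a = ⊤)
    (hcard : r ⊤ = Fintype.card ι) (S : Finset ι) : r (S.sup a) = S.card := by
  have h1 := hr.finset_sup_le_card ha S
  have h2 := hr.finset_sup_le_card ha Sᶜ
  have h3 := hr.sup_add_inf (S.sup a) (Sᶜ.sup a)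
  rw [sup_sup_compl htop] at h3
  have h4 := Finset.card_add_card_compl S
  omega

theorem finset_sup_inf_compl (hr : IsModularRank r) {ι : Type*} [Fintype ι] [DecidableEq ι]
    {a : ι → L} (ha : ∀ i, r (a i) = 1) (htop : Finset.univ.sup a = ⊤)
    (hcard : r ⊤ = Fintype.card ι) (S : Finset ι) : S.sup a ⊓ Sᶜ.sup a = ⊥ := by
  have h1 := hr.finset_sup_eq_card ha htop hcard S
  have h2 := hr.finset_sup_eq_card ha htop hcard Sᶜ
  have h3 := hr.sup_add_inf (S.sup a) (Sᶜ.sup a)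
  rw [sup_sup_compl htop] at h3
  have h4 := Finset.card_add_card_compl S
  exact hr.eq_bot (by omega)

end IsModularRank

/-- No element of `I(p,q)` other than `q` lies above all the neighbours of `p` in `I(p,q)`. -/
def AtomsJoinToTop (G : SimpleGraph V) (p q : V) : Prop :=
  ∀ x ∈ gInterval G p q, x ≠ q → ∃ a ∈ gInterval G p q, G.dist p a = 1 ∧ ¬ bpOrder G p a x

namespace IsSwm

variable {G : SimpleGraph V} {p q : V}

/-- The interval `I(p,q)` as a lattice under the base-point order. -/
@[reducible]
noncomputable def lattice (hG : IsSwm G) (p q : V) : Lattice (gInterval G p q) where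
  le x y := bpOrder G p x y
  le_refl x := IsSwm.le_refl x.1
  le_trans _ _ _ h h' := hG.le_trans h h'
  le_antisymm _ _ h h' := Subtype.ext (hG.le_antisymm h h')
  sup x y := ⟨(hG.exists_sup x.2 y.2).choose, (hG.exists_sup x.2 y.2).choose_spec.1⟩
  le_sup_left x y := (hG.exists_sup x.2 y.2).choose_spec.2.1
  le_sup_right x y := (hG.exists_sup x.2 y.2).choose_spec.2.2.1
  sup_le x y z h h' := (hG.exists_sup x.2 y.2).choose_spec.2.2.2 z.1 z.2 h h'
  inf x y := ⟨(hG.exists_inf x.2 y.2).choose, (hG.exists_inf x.2 y.2).choose_spec.1⟩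
  inf_le_left x y := (hG.exists_inf x.2 y.2).choose_spec.2.1
  inf_le_right x y := (hG.exists_inf x.2 y.2).choose_spec.2.2.1
  le_inf x y z h h' := (hG.exists_inf y.2 z.2).choose_spec.2.2.2 x.1 x.2 h h'

@[reducible]
def boundedOrder (hG : IsSwm G) (p q : V) :
    letI := hG.lattice p q
    BoundedOrder (gInterval G p q) :=
  letI := hG.lattice p q
  { bot := ⟨p, bot_mem⟩
    top := ⟨q, top_mem⟩
    bot_le := fun x => IsSwm.bot_le x.1
    le_top := fun x => x.2 }

theorem isModularRank (hG : IsSwm G) (p q : V) :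
    letI := hG.lattice p q
    letI := hG.boundedOrder p q
    IsModularRank fun x : gInterval G p q => G.dist p x := by
  let := hG.lattice p q
  let := hG.boundedOrder p q
  exact
    { bot := G.dist_self
      mono := fun _ _ h => dist_le_of_le h
      eq_of_le := fun h h' => Subtype.ext (hG.eq_of_le_of_dist_le h h')
      sup_add_inf := fun x y => hG.dist_inf_add_dist_sup x.2 y.2
        (hG.exists_inf x.2 y.2).choose_spec (hG.exists_sup x.2 y.2).choose_spec }

theorem relIsInf_unique (hG : IsSwm G) {x y m m' : V}
    (h : RelIsInf (gInterval G p q) (bpOrder G p) x y m)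
    (h' : RelIsInf (gInterval G p q) (bpOrder G p) x y m') : m = m' :=
  hG.le_antisymm (h'.2.2.2 m h.1 h.2.1 h.2.2.1) (h.2.2.2 m' h'.1 h'.2.1 h'.2.2.1)

theorem relIsSup_unique (hG : IsSwm G) {x y j j' : V}
    (h : RelIsSup (gInterval G p q) (bpOrder G p) x y j)
    (h' : RelIsSup (gInterval G p q) (bpOrder G p) x y j') : j = j' :=
  hG.le_antisymm (h.2.2.2 j' h'.1 h'.2.1 h'.2.2.1) (h'.2.2.2 j h.1 h.2.1 h.2.2.1)

theorem isModularLatticeRel (hG : IsSwm G) :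
    IsModularLatticeRel (gInterval G p q) (bpOrder G p) := by
  let := hG.lattice p q
  let := hG.boundedOrder p q
  refine ⟨fun x _ => IsSwm.le_refl x, fun x _ y _ => hG.le_antisymm,
    fun x _ y _ z _ => hG.le_trans, fun x hx y hy => hG.exists_inf hx hy,
    fun x hx y hy => hG.exists_sup hx hy, ?_⟩
  intro x hx y hy z hz hxz m j j' m' hm hj hj' hm'
  have h := (hG.isModularRank p q).modular_law (x := ⟨x, hx⟩) (y := ⟨y, hy⟩) (z := ⟨z, hz⟩) hxz
  have em := hG.relIsInf_unique hm (hG.exists_inf hy hz).choose_spec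
  subst em
  have ej' := hG.relIsSup_unique hj' (hG.exists_sup hx hy).choose_spec
  subst ej'
  have ej := hG.relIsSup_unique hj (hG.exists_sup hx hm.1).choose_spec
  have em' := hG.relIsInf_unique hm' (hG.exists_inf hj'.1 hz).choose_spec
  rw [ej, em']
  exact congrArg Subtype.val h

theorem isComplementedModularLatticeRel (hG : IsSwm G) (h : AtomsJoinToTop G p q) :
    IsComplementedModularLatticeRel (gInterval G p q) (bpOrder G p) := by
  let := hG.lattice p q
  let := hG.boundedOrder p q
  refine ⟨hG.isModularLatticeRel, p, bot_mem, q, top_mem, fun x _ => IsSwm.bot_le x,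
    fun x hx => hx, fun x hx => ?_⟩
  obtain ⟨y, hinf, hsup⟩ := (hG.isModularRank p q).exists_isCompl (fun x hx => by
    obtain ⟨a, ha, h1, h2⟩ := h x.1 x.2 fun h => hx (Subtype.ext h)
    exact ⟨⟨a, ha⟩, h1, h2⟩) ⟨x, hx⟩
  refine ⟨y.1, y.2, ?_, ?_⟩
  · have := (hG.exists_inf hx y.2).choose_spec
    rwa [show (hG.exists_inf hx y.2).choose = p from congrArg Subtype.val hinf] at this
  · have := (hG.exists_sup hx y.2).choose_spec
    rwa [show (hG.exists_sup hx y.2).choose = q from congrArg Subtype.val hsup] at this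

theorem exists_atom_le (hG : IsSwm G) {x : V} (h : x ≠ p) :
    ∃ a, G.dist p a = 1 ∧ bpOrder G p a x := by
  obtain ⟨a, ha, -, hax⟩ := hG.exists_cover (IsSwm.bot_le x) h.symm
  exact ⟨a, dist_of_adj ha, hax⟩

theorem atomsJoinToTop_of_isComplementedModularLatticeRel (hG : IsSwm G)
    (h : IsComplementedModularLatticeRel (gInterval G p q) (bpOrder G p)) :
    AtomsJoinToTop G p q := by
  obtain ⟨-, bot, hbot, top, htop, hb, ht, hc⟩ := h
  obtain rfl : bot = p := hG.le_antisymm (hb p bot_mem) (IsSwm.bot_le bot)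
  obtain rfl : top = q := hG.le_antisymm htop (ht q top_mem)
  intro x hx hxq
  obtain ⟨y, hy, hinf, hsup⟩ := hc x hx
  have hyp : y ≠ bot := by
    rintro rfl
    exact hxq (hG.le_antisymm hx (hsup.2.2.2 x hx (le_refl x) (IsSwm.bot_le x)))
  obtain ⟨a, ha, hay⟩ := hG.exists_atom_le hyp
  refine ⟨a, hG.mem_of_le hy hay, ha, fun hax => ?_⟩
  have := hG.le_antisymm (hinf.2.2.2 a (hG.mem_of_le hy hay) hax hay) (IsSwm.bot_le a)
  subst this
  simp at ha

theorem cubeEmbedded_of_atomsJoinToTop (hG : IsSwm G) (h : AtomsJoinToTop G p q) :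
    CubeEmbedded G p q := by
  classical
  let := hG.lattice p q
  let := hG.boundedOrder p q
  have hr := hG.isModularRank p q
  obtain ⟨a, ha, htop⟩ := hr.exists_atoms_sup_eq_top (fun x hx => by
    obtain ⟨a, ha, h1, h2⟩ := h x.1 x.2 fun h => hx (Subtype.ext h)
    exact ⟨⟨a, ha⟩, h1, h2⟩)
  change Fin (G.dist p q) → gInterval G p q at a
  have hcard : G.dist p (⊤ : gInterval G p q) = Fintype.card (Fin (G.dist p q)) :=
    (Fintype.card_fin _).symm
  have rank : ∀ S : Finset (Fin (G.dist p q)), G.dist p (S.sup a : gInterval G p q) = S.card :=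
    fun S => hr.finset_sup_eq_card ha htop hcard S
  have hsub : ∀ S T : Finset (Fin (G.dist p q)), S ⊆ T →
      G.dist (S.sup a : gInterval G p q) (T.sup a : gInterval G p q) + S.card = T.card := by
    intro S T hST
    have h1 : G.dist p (S.sup a : gInterval G p q) +
        G.dist (S.sup a : gInterval G p q) (T.sup a : gInterval G p q) =
        G.dist p (T.sup a : gInterval G p q) :=
      (Finset.sup_mono hST : S.sup a ≤ T.sup a)
    have h2 := rank S
    have h3 := rank T
    omega
  have hle : ∀ S T : Finset (Fin (G.dist p q)),
      G.dist (S.sup a : gInterval G p q) (T.sup a : gInterval G p q) ≤ (S \ T).card + (T \ S).card := by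
    intro S T
    have h1 := hsub (S ∩ T) S Finset.inter_subset_left
    have h2 := hsub (S ∩ T) T Finset.inter_subset_right
    have h3 := hG.tri (S.sup a : gInterval G p q) ((S ∩ T).sup a : gInterval G p q)
      (T.sup a : gInterval G p q)
    have h4 := G.dist_comm (u := (S.sup a : gInterval G p q).1)
      (v := ((S ∩ T).sup a : gInterval G p q))
    have h5 := Finset.card_sdiff_add_card_inter S T
    have h6 := Finset.card_sdiff_add_card_inter T S
    rw [Finset.inter_comm T S] at h6
    omega
  have hcompl : ∀ S : Finset (Fin (G.dist p q)),
      G.dist (S.sup a : gInterval G p q) (Sᶜ.sup a : gInterval G p q) = G.dist p q := by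
    intro S
    have h1 := Finset.card_add_card_compl S
    rw [Fintype.card_fin] at h1
    rw [hG.dist_eq_add (S.sup a).2 (Sᶜ.sup a).2, rank, rank, h1]
    intro w h1 h2
    have h3 : (⟨w, hG.mem_of_le (S.sup a).2 h1⟩ : gInterval G p q) ≤ S.sup a ⊓ Sᶜ.sup a :=
      le_inf h1 h2
    rw [hr.finset_sup_inf_compl ha htop hcard S] at h3
    exact hG.le_antisymm h3 (IsSwm.bot_le w)
  refine ⟨fun A => ((Finset.univ.filter fun i => A i).sup a : gInterval G p q),
    fun A => Subtype.property _, fun A B => ?_⟩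
  set S := Finset.univ.filter fun i => A i = true with hS
  set T := Finset.univ.filter fun i => B i = true with hT
  have hunion : (Finset.univ.filter fun i => A i ≠ B i) = (S \ T) ∪ (T \ S) := by
    ext i
    simp only [hS, hT, Finset.mem_filter, Finset.mem_univ, true_and, Finset.mem_union,
      Finset.mem_sdiff]
    cases A i <;> cases B i <;> simp
  change G.dist (S.sup a : gInterval G p q) (T.sup a : gInterval G p q) = _
  rw [hunion, Finset.card_union_of_disjoint (disjoint_sdiff_sdiff)]
  refine _root_.le_antisymm (hle S T) ?_
  have h1 := hcompl S
  have h2 := hG.tri (S.sup a : gInterval G p q) (T.sup a : gInterval G p q)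
    (Sᶜ.sup a : gInterval G p q)
  have h3 := hle T Sᶜ
  have h4 : T \ Sᶜ = T ∩ S := by ext; simp
  have h5 : Sᶜ \ T = (S ∪ T)ᶜ := by ext; simp
  rw [h4, h5] at h3
  have h6 := Finset.card_add_card_compl (S ∪ T)
  have h7 := Finset.card_union_add_card_inter S T
  have h8 := Finset.card_sdiff_add_card_inter S T
  have h9 := Finset.card_sdiff_add_card_inter T S
  rw [Finset.inter_comm T S] at h3 h9
  rw [Fintype.card_fin] at h6
  omega

theorem atomsJoinToTop_of_cycle (hG : IsSwm G)
    (h : IsIsometricCycleThrough G (G.dist p q) p q) : AtomsJoinToTop G p q := by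
  obtain ⟨c, hc, ⟨i, hi, rfl⟩, ⟨j, hj, rfl⟩⟩ := h
  set p := c i with hp
  set q := c j with hq
  set k := G.dist p q with hk
  have hij := hc i hi j hj
  rw [← hp, ← hq, ← hk] at hij
  obtain ⟨e, he⟩ : ∃ e : ℕ → V, e = fun n => c (if i + n < 2 * k then i + n else i + n - 2 * k) :=
    ⟨_, rfl⟩
  have hdist : ∀ m n, m ≤ n → n < 2 * k →
      G.dist (e m) (e n) = min (n - m) (2 * k - (n - m)) := by
    intro m n hmn hn
    rw [he]
    dsimp only
    rw [hc _ (by split_ifs <;> omega) _ (by split_ifs <;> omega)]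
    split_ifs <;> omega
  have e0 : e 0 = p := by simp [he, hi, hp]
  have ek : e k = q := by
    rw [he, hq]
    dsimp only
    congr 1
    split_ifs <;> omega
  have rank : ∀ n < 2 * k, G.dist p (e n) = min n (2 * k - n) := by
    intro n hn
    rw [← e0, hdist 0 n (by omega) hn]
    simp
  have mem : ∀ n < 2 * k, e n ∈ gInterval G p q := by
    intro n hn
    change G.dist p (e n) + G.dist (e n) q = k
    rw [rank n hn, ← ek]
    rcases Nat.le_total n k with h | h
    · rw [hdist n k h (by omega)]; omega
    · rw [G.dist_comm, hdist k n h hn]; omega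
  intro x hx hxq
  by_contra! hall
  refine hxq (hG.le_antisymm (p := p) hx ?_)
  rw [← ek]
  suffices H : ∀ n ≤ k, bpOrder G p (e n) x from H k _root_.le_rfl
  intro n
  induction n with
  | zero => exact fun _ => e0 ▸ IsSwm.bot_le x
  | succ n ih =>
    intro hn
    have hle := ih (by omega)
    have hX := mem (n + 1) (by omega)
    have hY := mem (k + n) (by omega)
    have rX := rank (n + 1) (by omega)
    have rY := rank (k + n) (by omega)
    have rn := rank n (by omega)
    obtain ⟨m, mX, mY, hm⟩ := hG.exists_lower_bound top_mem hX hY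
    have hmp : m ≠ p := by
      rintro rfl
      rw [G.dist_self] at hm
      omega
    obtain ⟨a, ha, ham⟩ := hG.exists_atom_le hmp
    have haX := hG.le_trans ham mX
    have haY := hG.le_trans ham mY
    have haI := hG.mem_of_le hX haX
    obtain ⟨s, hs, ns, as, mins⟩ := hG.exists_sup (mem n (by omega)) haI
    have hnX : bpOrder G p (e n) (e (n + 1)) := by
      simp only [bpOrder, gInterval, Set.mem_ofPred_eq]
      rw [rX, rn, hdist n (n + 1) (by omega) (by omega)]
      omega
    have hsX := mins _ hX hnX haX
    have hna : ¬ bpOrder G p a (e n) := by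
      intro han
      have h1 := hdist n (k + n) (by omega) (by omega)
      have h2 := hG.tri (e n) a (e (k + n))
      have h3 := G.dist_comm (u := e n) (v := a)
      simp only [bpOrder, gInterval, Set.mem_ofPred_eq] at han haY
      omega
    have hns : G.dist p (e n) < G.dist p s := by
      by_contra hlt
      exact hna (hG.eq_of_le_of_dist_le ns (by omega) ▸ as)
    rw [← hG.eq_of_le_of_dist_le hsX (by omega)]
    exact mins x hx hle (hall a haI ha)

/-- An isometric cube in `I(p,q)` of dimension `d(p,q)` may be relabelled so that its bottom and
top vertices are `p` and `q`. -/
theorem exists_cube_antipodal (hG : IsSwm G) (h : CubeEmbedded G p q) :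
    ∃ f : (Fin (G.dist p q) → Bool) → V,
      (∀ A B, G.dist (f A) (f B) = (Finset.univ.filter fun i => A i ≠ B i).card) ∧
      f (fun _ => false) = p ∧ f (fun _ => true) = q := by
  classical
  obtain ⟨f, hf, hd⟩ := h
  obtain ⟨A, hA⟩ : ∃ A, ∀ B, G.dist p (f A) ≤ G.dist p (f B) :=
    Finite.exists_min fun A => G.dist p (f A)
  have step : ∀ B (i : Fin (G.dist p q)) (b : Bool), B i ≠ b →
      G.Adj (f B) (f (Function.update B i b)) := by
    intro B i b hb
    rw [← SimpleGraph.dist_eq_one_iff_adj, hd, Finset.card_eq_one]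
    refine ⟨i, ?_⟩
    ext l
    by_cases hl : l = i
    · subst hl; simpa using hb
    · simp [hl]
  have level : ∀ B B', G.Adj (f B) (f B') →
      G.dist p (f B) = G.dist p (f B') + 1 ∨ G.dist p (f B') = G.dist p (f B) + 1 := by
    intro B B' hadj
    have h1 : G.dist p (f B) ≠ G.dist p (f B') :=
      fun h => hG.not_adj_of_dist_eq (hf B) (hf B') h hadj
    have h2 := hG.tri p (f B) (f B')
    have h3 := hG.tri p (f B') (f B)
    have h4 := dist_of_adj hadj
    have h5 := dist_of_adj hadj.symm
    omega
  have hupd : ∀ B (i : Fin (G.dist p q)),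
      (Finset.univ.filter fun l => A l ≠ Function.update B i (A i) l) =
        (Finset.univ.filter fun l => A l ≠ B l).erase i := by
    intro B i
    ext l
    by_cases hl : l = i
    · subst hl; simp
    · simp [hl]
  have rank : ∀ n B, (Finset.univ.filter fun l => A l ≠ B l).card = n →
      G.dist p (f B) = G.dist p (f A) + n := by
    intro n
    induction n using Nat.strong_induction_on with
    | _ n ih =>
    intro B hB
    rcases n with _ | n
    · have : G.dist (f A) (f B) = 0 := by rw [hd, hB]
      rw [hG.eq_of_dist this, add_zero]
    obtain ⟨i, hi⟩ := Finset.card_pos.mp (by omega : 0 < (Finset.univ.filter fun l => A l ≠ B l).card)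
    have hBi : B i ≠ A i := fun h => (Finset.mem_filter.mp hi).2 h.symm
    have adji := step B i (A i) hBi
    have ci := hupd B i
    set Bi := Function.update B i (A i) with hBidef
    have ki : (Finset.univ.filter fun l => A l ≠ Bi l).card = n := by
      rw [ci, Finset.card_erase_of_mem hi, hB]; rfl
    have ri := ih n (by omega) Bi ki
    have lB := level _ _ adji
    rcases n with _ | n
    · have := hA B
      omega
    obtain ⟨j, hj⟩ := Finset.card_pos.mp
      (by omega : 0 < (Finset.univ.filter fun l => A l ≠ Bi l).card)
    have hji : j ≠ i := fun h => by
      rw [ci, h] at hj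
      simp at hj
    have hBij : Bi j ≠ A j := fun h => (Finset.mem_filter.mp hj).2 h.symm
    have hBj : B j ≠ A j := by simpa [hBidef, hji] using hBij
    have hj' : j ∈ Finset.univ.filter fun l => A l ≠ B l := by
      simpa using hBj.symm
    have adjij := step Bi j (A j) hBij
    have cij := hupd Bi j
    have adjj := step B j (A j) hBj
    have cj := hupd B j
    set Bj := Function.update B j (A j) with hBjdef
    set Bij := Function.update Bi j (A j) with hBijdef
    have kij : (Finset.univ.filter fun l => A l ≠ Bij l).card = n := by
      rw [cij, Finset.card_erase_of_mem hj, ki]; rfl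
    have kj : (Finset.univ.filter fun l => A l ≠ Bj l).card = n + 1 := by
      rw [cj, Finset.card_erase_of_mem hj', hB]; rfl
    have rij := ih n (by omega) Bij kij
    have rj := ih (n + 1) (by omega) Bj kj
    have hcomm : Function.update Bj i (A i) = Bij := by
      rw [hBjdef, hBijdef, hBidef, Function.update_comm hji]
    have adjji := step Bj i (A i) (by simpa [hBjdef, hji.symm] using hBi)
    rw [hcomm] at adjji
    by_contra hne
    have hBB : f B ≠ f Bij := by
      intro h
      have h1 : G.dist (f B) (f Bij) = 0 := by rw [h]; exact G.dist_self
      rw [hd, Finset.card_eq_zero, Finset.filter_eq_empty_iff] at h1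
      have h2 := h1 (Finset.mem_univ j)
      simp [hBijdef, hBj] at h2
    have huniq := hG.common_cover_unique (hf Bi) (hf Bj) hBB adji adjj adjij.symm adjji.symm
      (by omega) (by omega) (by omega)
    have h1 : G.dist (f Bi) (f Bj) = 0 := by rw [huniq]; exact G.dist_self
    rw [hd, Finset.card_eq_zero, Finset.filter_eq_empty_iff] at h1
    have h2 := h1 (Finset.mem_univ i)
    simp [hBidef, hBjdef, hji.symm, hBi.symm] at h2
  have hfull : (Finset.univ.filter fun l => A l ≠ !A l).card = G.dist p q := by simp
  have htop := rank _ (fun l => !A l) hfull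
  have hmem := dist_swap (hf fun l => !A l)
  refine ⟨fun B => f fun l => xor (A l) (B l), fun B C => ?_, ?_, ?_⟩
  · rw [hd]
    congr 1
    ext l
    cases A l <;> simp
  · simp only [Bool.xor_false]
    exact (hG.eq_of_dist (by omega : G.dist p (f A) = 0)).symm
  · simp only [Bool.xor_true]
    exact (hG.eq_of_dist (by omega)).symm

theorem cycle_of_cubeEmbedded (hG : IsSwm G) (hk : 2 ≤ G.dist p q) (h : CubeEmbedded G p q) :
    IsIsometricCycleThrough G (G.dist p q) p q := by
  classical
  obtain ⟨f, hd, hp, hq⟩ := hG.exists_cube_antipodal h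
  have count : ∀ s : Finset ℕ, s ⊆ Finset.range (G.dist p q) →
      (Finset.univ.filter fun l : Fin (G.dist p q) => (l : ℕ) ∈ s).card = s.card := by
    intro s hs
    rw [← Finset.card_map Fin.valEmbedding]
    congr 1
    ext l
    simp only [Finset.mem_map, Finset.mem_filter, Finset.mem_univ, true_and,
      Fin.valEmbedding_apply]
    exact ⟨by rintro ⟨a, ha, rfl⟩; exact ha,
      fun hl => ⟨⟨l, Finset.mem_range.mp (hs hl)⟩, hl, rfl⟩⟩
  generalize hkdef : G.dist p q = k at *
  obtain ⟨S, hS⟩ : ∃ S : ℕ → Finset ℕ,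
      S = fun i => if i ≤ k then Finset.range i else Finset.Ico (i - k) k := ⟨_, rfl⟩
  let c : ℕ → V := fun i => f fun l => decide ((l : ℕ) ∈ S i)
  have key : ∀ i j, i ≤ j → j < 2 * k →
      G.dist (c i) (c j) = min (j - i) (2 * k - (j - i)) := by
    intro i j hij hj
    have hcount : ∀ s : Finset ℕ, (∀ l, l ∈ s ↔ l < k ∧ ¬ (l ∈ S i ↔ l ∈ S j)) →
        G.dist (c i) (c j) = s.card := by
      intro s hs
      rw [hd, ← count s fun l hl => Finset.mem_range.mpr ((hs l).mp hl).1]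
      congr 1
      ext l
      simp [hs]
    by_cases h1 : j ≤ k
    · rw [hcount (Finset.Ico i j), Nat.card_Ico]
      · omega
      · intro l
        simp only [hS, if_pos h1, if_pos (hij.trans h1), Finset.mem_range, Finset.mem_Ico]
        omega
    by_cases h2 : i ≤ k
    · by_cases h3 : i ≤ j - k
      · rw [hcount (Finset.range i ∪ Finset.Ico (j - k) k), Finset.card_union_of_disjoint,
          Finset.card_range, Nat.card_Ico]
        · omega
        · rw [Finset.disjoint_left]
          intro l
          simp only [Finset.mem_range, Finset.mem_Ico]
          omega
        · intro l
          simp only [hS, if_neg h1, if_pos h2, Finset.mem_range, Finset.mem_Ico, Finset.mem_union]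
          omega
      · rw [hcount (Finset.range (j - k) ∪ Finset.Ico i k), Finset.card_union_of_disjoint,
          Finset.card_range, Nat.card_Ico]
        · omega
        · rw [Finset.disjoint_left]
          intro l
          simp only [Finset.mem_range, Finset.mem_Ico]
          omega
        · intro l
          simp only [hS, if_neg h1, if_pos h2, Finset.mem_range, Finset.mem_Ico, Finset.mem_union]
          omega
    · rw [hcount (Finset.Ico (i - k) (j - k)), Nat.card_Ico]
      · omega
      · intro l
        simp only [hS, if_neg h1, if_neg h2, Finset.mem_Ico]
        omega
  refine ⟨c, fun i hi j hj => ?_, ⟨0, by omega, ?_⟩, ⟨k, by omega, ?_⟩⟩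
  · rcases Nat.le_total i j with hij | hij
    · rw [key i j hij hj, max_eq_right hij, min_eq_left hij]
    · rw [G.dist_comm, key j i hij hi, max_eq_left hij, min_eq_right hij]
  · simp [c, hS, hp]
  · simp [c, hS, hq]

end IsSwm

theorem statement1 (G : SimpleGraph V) (hconn : G.Connected) (hwm : WeaklyModular G)
    (h4 : ¬ HasInducedK4minus G) (h33 : ¬ HasIsometricK33minus G)
    (p q : V) (hk : 2 ≤ G.dist p q) :
    (CubeEmbedded G p q ↔ IsIsometricCycleThrough G (G.dist p q) p q) ∧
    (CubeEmbedded G p q ↔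
      IsComplementedModularLatticeRel (gInterval G p q) (bpOrder G p)) := by
  have hG : IsSwm G := ⟨hconn, hwm.1, hwm.2, h4, h33⟩
  have hcyc : CubeEmbedded G p q → IsIsometricCycleThrough G (G.dist p q) p q :=
    hG.cycle_of_cubeEmbedded hk
  exact ⟨⟨hcyc, fun h => hG.cubeEmbedded_of_atomsJoinToTop (hG.atomsJoinToTop_of_cycle h)⟩,
    fun h => hG.isComplementedModularLatticeRel (hG.atomsJoinToTop_of_cycle (hcyc h)),
    fun h => hG.cubeEmbedded_of_atomsJoinToTop
      (hG.atomsJoinToTop_of_isComplementedModularLatticeRel h)⟩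
end
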